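/- arXiv:1302.4117 — 2 statements merged into one kernel-verified Lean document; each statement's English description precedes it below -/
import Mathlib

section
/- Let 2 ≤ d < ∞, let q₁,…,q_d be multiplicatively independent integers ≥ 2, let c_{q_1},…,c_{q_d} be nonzero complex numbers and c₁ ∈ ℂ with Re c₁ − ∑_{j=1}^d |c_{q_j}| = 1/2, and set φ(s) = c₁ + ∑_{j=1}^d c_{q_j} q_j^{−s}. Then the composition operator C_φ is bounded on ℋ², ∑_{n≥1} a_n(C_φ)^p < ∞ for every p > 2/(d−1), and ∑_{n≥1} a_n(C_φ)^{2/(d−1)} = ∞. -/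
open Complex Filter MeasureTheory

noncomputable section

/-- The Hilbert space `ℋ²` of Dirichlet series with square-summable coefficients,
modeled by its coefficient sequences (indexed by `ℕ+`). -/
abbrev H2 := ↥(lp (fun _ : ℕ+ => ℂ) 2)

/-- The Dirichlet series attached to an element of `ℋ²`; it converges on `Re s > 1/2`. -/
noncomputable def H2series (x : H2) (s : ℂ) : ℂ := ∑' n : ℕ+, x n * (n : ℂ) ^ (-s)

/-- `T` is (the bounded operator realizing) the composition operator `C_φ` on `ℋ²`:
for every `f ∈ ℋ²`, the Dirichlet series of `T f` agrees with `f ∘ φ` on `ℂ_{1/2}`. -/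
def IsCompOp (φ : ℂ → ℂ) (T : H2 →L[ℂ] H2) : Prop :=
  ∀ (x : H2) (s : ℂ), 1 / 2 < s.re → H2series (T x) s = H2series x (φ s)

/-- The `n`-th approximation number of a bounded operator: the distance in operator
norm to the operators of rank `< n`. -/
noncomputable def approxNumber {E F : Type*} [NormedAddCommGroup E] [NormedSpace ℂ E]
    [NormedAddCommGroup F] [NormedSpace ℂ F] (T : E →L[ℂ] F) (n : ℕ) : ℝ :=
  sInf {c : ℝ | ∃ R : E →L[ℂ] F,
    FiniteDimensional ℂ (LinearMap.range (R : E →ₗ[ℂ] F)) ∧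
    Module.finrank ℂ (LinearMap.range (R : E →ₗ[ℂ] F)) < n ∧ c = ‖T - R‖}

/-- The positive integers `q j ≥ 2` are multiplicatively independent. -/
def MultIndep {d : ℕ} (q : Fin d → ℕ) : Prop :=
  ∀ α β : Fin d → ℕ, ∏ j, q j ^ α j = ∏ j, q j ^ β j → α = β

/-! ### Poisson weights -/

/-- The Poisson weight `e^{-l} l^k / k!`. -/
def pois (l : ℝ) (k : ℕ) : ℝ := Real.exp (-l) * (l ^ k / k.factorial)

lemma pois_nonneg {l : ℝ} (hl : 0 ≤ l) (k : ℕ) : 0 ≤ pois l k := by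
  unfold pois; positivity

lemma hasSum_exp_series (l : ℝ) : HasSum (fun k : ℕ => l ^ k / k.factorial) (Real.exp l) := by
  rw [Real.exp_eq_exp_ℝ]; exact NormedSpace.expSeries_div_hasSum_exp l

lemma hasSum_pois (l : ℝ) : HasSum (pois l) 1 := by
  have := (hasSum_exp_series l).mul_left (Real.exp (-l))
  rwa [← Real.exp_add, neg_add_cancel, Real.exp_zero] at this

lemma sum_pois_le_one {l : ℝ} (hl : 0 ≤ l) (s : Finset ℕ) : ∑ k ∈ s, pois l k ≤ 1 :=
  sum_le_hasSum s (fun k _ => pois_nonneg hl k) (hasSum_pois l)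

lemma pois_succ_mul (l : ℝ) (k : ℕ) : pois l (k + 1) * ((k : ℝ) + 1) = l * pois l k := by
  unfold pois
  rw [Nat.factorial_succ, pow_succ]
  push_cast
  field_simp

lemma hasSum_pois_mul_id (l : ℝ) : HasSum (fun k : ℕ => pois l k * k) l := by
  rw [hasSum_nat_add_iff' 1 |>.symm]
  simp only [Finset.range_one, Finset.sum_singleton, Nat.cast_zero, mul_zero, sub_zero]
  have := (hasSum_pois l).mul_left l
  rw [mul_one] at this
  refine this.congr_fun ?_
  intro k
  rw [← pois_succ_mul]; push_cast; ring

lemma hasSum_pois_mul_sq (l : ℝ) : HasSum (fun k : ℕ => pois l k * k ^ 2) (l * (l + 1)) := by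
  rw [hasSum_nat_add_iff' 1 |>.symm]
  simp only [Finset.range_one, Finset.sum_singleton, Nat.cast_zero, ne_eq, OfNat.ofNat_ne_zero,
    not_false_eq_true, zero_pow, mul_zero, sub_zero]
  refine (((hasSum_pois_mul_id l).add (hasSum_pois l)).mul_left l).congr_fun fun k => ?_
  have := pois_succ_mul l k
  push_cast
  calc _ = (pois l (k + 1) * ((k : ℝ) + 1)) * (k + 1) := by ring
    _ = _ := by rw [this]; ring

lemma hasSum_pois_variance (l : ℝ) : HasSum (fun k : ℕ => pois l k * ((k : ℝ) - l) ^ 2) l := by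
  have := ((hasSum_pois_mul_sq l).sub ((hasSum_pois_mul_id l).mul_left (2 * l))).add
    ((hasSum_pois l).mul_left (l ^ 2))
  rw [show l * (l + 1) - 2 * l * l + l ^ 2 * 1 = l by ring] at this
  exact this.congr_fun fun k => by ring

/-- Chebyshev's inequality for the Poisson distribution. -/
lemma one_sub_le_sum_pois {l B : ℝ} (hl : 0 ≤ l) (hB : 0 < B) (A : Finset ℕ)
    (hA : ∀ k ∉ A, B ≤ ((k : ℝ) - l) ^ 2) : 1 - l / B ≤ ∑ k ∈ A, pois l k := by
  have h1 : HasSum (fun k : ℕ => pois l k - pois l k * ((k : ℝ) - l) ^ 2 / B) (1 - l / B) :=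
    (hasSum_pois l).sub ((hasSum_pois_variance l).div_const B)
  have h2 : HasSum (fun k => if k ∈ A then pois l k else 0) (∑ k ∈ A, pois l k) := by
    have : HasSum (fun k => if k ∈ A then pois l k else 0)
        (∑ k ∈ A, if k ∈ A then pois l k else 0) :=
      hasSum_sum_of_ne_finset_zero fun b hb => if_neg hb
    rwa [Finset.sum_congr rfl fun k hk => if_pos hk] at this
  refine hasSum_le (fun k => ?_) h1 h2
  have hp := pois_nonneg hl k
  split_ifs with h
  · have : 0 ≤ pois l k * ((k : ℝ) - l) ^ 2 / B := by positivity
    linarith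
  · have : pois l k ≤ pois l k * ((k : ℝ) - l) ^ 2 / B := by
      rw [le_div_iff₀ hB]
      exact mul_le_mul_of_nonneg_left (hA k h) hp
    linarith

lemma hasDerivAt_sum_pois (k : ℕ) (l : ℝ) :
    HasDerivAt (fun l => ∑ i ∈ Finset.range (k + 1), pois l i) (-pois l k) l := by
  have hd : ∀ j : ℕ, HasDerivAt (fun l => pois l (j + 1)) (pois l j - pois l (j + 1)) l := by
    intro j
    have h1 : HasDerivAt (fun l : ℝ => Real.exp (-l)) (-Real.exp (-l)) l := by
      simpa using (hasDerivAt_neg l).exp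
    have h2 : HasDerivAt (fun l : ℝ => l ^ (j + 1) / (j + 1).factorial)
        (((j + 1 : ℕ) : ℝ) * l ^ j / (j + 1).factorial) l := by
      simpa using (hasDerivAt_pow (j + 1) l).div_const ((j + 1).factorial : ℝ)
    refine (h1.mul h2).congr_deriv ?_
    unfold pois
    rw [Nat.factorial_succ]
    push_cast
    field_simp
    ring
  induction k with
  | zero =>
    have h1 : HasDerivAt (fun l : ℝ => Real.exp (-l)) (-Real.exp (-l)) l := by
      simpa using (hasDerivAt_neg l).exp
    simpa [pois] using h1
  | succ k ih =>
    simp_rw [Finset.sum_range_succ _ (k + 1)]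
    refine (ih.add (hd k)).congr_deriv ?_
    ring

/-! ### Sums over `log n` -/

lemma summable_and_tsum_le_of_telescope {f : ℕ+ → ℝ} {G : ℕ → ℝ} {C : ℝ} (hf : ∀ n, 0 ≤ f n)
    (hC : 0 ≤ C) (hG : ∀ n, 0 ≤ G n) (h : ∀ n : ℕ+, f n ≤ C * (G n - G (n + 1))) :
    Summable f ∧ ∑' n, f n ≤ C * G 1 := by
  have hb : ∀ n, ∑ i ∈ Finset.range n, f i.succPNat ≤ C * G 1 := by
    intro n
    calc ∑ i ∈ Finset.range n, f i.succPNat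
        ≤ ∑ i ∈ Finset.range n, C * (G (i + 1) - G (i + 1 + 1)) :=
          Finset.sum_le_sum fun i _ => h i.succPNat
      _ = C * (G 1 - G (n + 1)) := by
          rw [← Finset.mul_sum, Finset.sum_range_sub' (fun i => G (i + 1))]
      _ ≤ C * G 1 := by gcongr; linarith [hG (n + 1)]
  have hs := summable_of_sum_range_le (fun n => hf n.succPNat) hb
  have e := Equiv.pnatEquivNat.symm
  have he : (fun n : ℕ => f n.succPNat) = f ∘ Equiv.pnatEquivNat.symm := rfl
  constructor
  · rw [he] at hs; exact (Equiv.summable_iff _).1 hs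
  · rw [← Equiv.pnatEquivNat.symm.tsum_eq]
    exact hs.tsum_le_of_sum_range_le hb

lemma one_div_le_log_succ_sub_log (n : ℕ+) :
    1 / (n : ℝ) ≤ 2 * (Real.log ((n : ℕ) + 1 : ℕ) - Real.log n) := by
  have hn : (1 : ℝ) ≤ n := by exact_mod_cast n.pos
  have h := Real.one_sub_inv_le_log_of_pos (x := ((n : ℝ) + 1) / n) (by positivity)
  rw [Real.log_div (by positivity) (by positivity)] at h
  push_cast
  have : 1 / (n : ℝ) ≤ 2 * (1 - (((n : ℝ) + 1) / n)⁻¹) := by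
    rw [inv_div, one_sub_div (by positivity)]
    rw [div_le_iff₀ (by positivity)]
    field_simp
    linarith
  linarith

lemma log_succ_sub_log_le (n : ℕ+) :
    Real.log ((n : ℕ) + 1 : ℕ) - Real.log n ≤ Real.log 2 := by
  have hn : (1 : ℝ) ≤ n := by exact_mod_cast n.pos
  rw [← Real.log_div (by positivity) (by positivity)]
  apply Real.log_le_log (by positivity)
  rw [div_le_iff₀ (by positivity)]
  push_cast; linarith

lemma log_succ_sub_log_pos (n : ℕ+) :
    0 < Real.log ((n : ℕ) + 1 : ℕ) - Real.log n := by
  have hn : (0 : ℝ) < n := by exact_mod_cast n.pos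
  rw [sub_pos]
  apply Real.log_lt_log hn
  push_cast; linarith

lemma log_pnat_nonneg (n : ℕ+) : 0 ≤ Real.log n := Real.log_natCast_nonneg _

lemma summable_pois_log_div {S : ℝ} (hS : 0 < S) (k : ℕ) :
    Summable (fun n : ℕ+ => pois (S * Real.log n) k / n) ∧
      ∑' n : ℕ+, pois (S * Real.log n) k / n ≤ 2 * Real.exp (S * Real.log 2) / S := by
  set G : ℕ → ℝ := fun n => ∑ i ∈ Finset.range (k + 1), pois (S * Real.log n) i with hGdef
  have hG0 : ∀ n : ℕ, 0 ≤ G n := fun n => Finset.sum_nonneg fun i _ =>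
    pois_nonneg (mul_nonneg hS.le (Real.log_natCast_nonneg n)) i
  have hG1 : G 1 ≤ 1 := sum_pois_le_one (by simp) _
  have key : ∀ n : ℕ+, pois (S * Real.log n) k / n ≤
      (2 * Real.exp (S * Real.log 2) / S) * (G n - G (n + 1)) := by
    intro n
    set u := S * Real.log n with hu
    set v := S * Real.log ((n : ℕ) + 1 : ℕ) with hv
    have hu0 : 0 ≤ u := mul_nonneg hS.le (log_pnat_nonneg n)
    have huv : u < v := by
      have := log_succ_sub_log_pos n
      rw [hu, hv]; gcongr; linarith
    obtain ⟨c, ⟨hc1, hc2⟩, hc⟩ := exists_hasDerivAt_eq_slope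
      (fun l => ∑ i ∈ Finset.range (k + 1), pois l i) (fun l => -pois l k) huv
      (fun x _ => (hasDerivAt_sum_pois k x).continuousAt.continuousWithinAt)
      (fun x _ => hasDerivAt_sum_pois k x)
    have hGuv : G n - G (n + 1) = pois c k * (v - u) := by
      have : v - u ≠ 0 := by linarith
      rw [eq_div_iff this] at hc
      simp only [hGdef]
      rw [← hu, ← hv]; linarith
    have hvu : v - u ≤ S * Real.log 2 := by
      rw [hu, hv, ← mul_sub]; gcongr; exact log_succ_sub_log_le n
    have hHar : pois u k ≤ Real.exp (S * Real.log 2) * pois c k := by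
      unfold pois
      rw [← mul_assoc, ← Real.exp_add]
      gcongr
      · linarith
    have hn : 1 / (n : ℝ) ≤ 2 * ((v - u) / S) := by
      have := one_div_le_log_succ_sub_log n
      rwa [hu, hv, ← mul_sub, mul_div_cancel_left₀ _ hS.ne']
    rw [hGuv]
    calc pois u k / n = pois u k * (1 / n) := by ring
      _ ≤ (Real.exp (S * Real.log 2) * pois c k) * (2 * ((v - u) / S)) := by
          apply mul_le_mul hHar hn (by positivity)
          exact mul_nonneg (by positivity) (pois_nonneg (by linarith) k)
      _ = _ := by ring
  have hC : 0 ≤ 2 * Real.exp (S * Real.log 2) / S := by positivity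
  obtain ⟨h1, h2⟩ := summable_and_tsum_le_of_telescope
    (f := fun n : ℕ+ => pois (S * Real.log n) k / n)
    (fun n => div_nonneg (pois_nonneg (mul_nonneg hS.le (log_pnat_nonneg n)) k) (by positivity))
    hC hG0 key
  exact ⟨h1, h2.trans (mul_le_of_le_one_right hC hG1)⟩

lemma summable_one_div_mul_log_sq :
    Summable (fun n : ℕ+ => 1 / ((n : ℝ) * (1 + Real.log n) ^ 2)) := by
  refine (summable_and_tsum_le_of_telescope (C := 4) (G := fun n => 1 / (1 + Real.log n))
    (fun n => ?_) (by norm_num) (fun n => ?_) (fun n => ?_)).1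
  · positivity
  · have := Real.log_natCast_nonneg n
    positivity
  · have h0 := log_pnat_nonneg n
    have h1 := one_div_le_log_succ_sub_log n
    have h2 := log_succ_sub_log_le n
    have h3 := log_succ_sub_log_pos n
    have hl2 := Real.log_two_lt_d9
    set u := Real.log n
    set v := Real.log ((n : ℕ) + 1 : ℕ)
    have hv : 1 + v ≤ 2 * (1 + u) := by linarith
    have hv0 : 0 < 1 + v := by linarith
    calc 1 / ((n : ℝ) * (1 + u) ^ 2) = (1 / n) * (1 / (1 + u) ^ 2) := by
          rw [one_div_mul_one_div]
      _ ≤ (2 * (v - u)) * (2 / ((1 + u) * (1 + v))) := by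
          apply mul_le_mul h1 _ (by positivity) (by linarith)
          rw [div_le_div_iff₀ (by positivity) (by positivity)]
          nlinarith
      _ = 4 * (1 / (1 + u) - 1 / (1 + v)) := by
          field_simp; ring

/-! ### Multinomial weights -/

lemma pois_le_one_div_sqrt {l : ℝ} (hl : 0 ≤ l) (m : ℕ) : pois l m ≤ 1 / √((m : ℝ) + 1) := by
  rcases Nat.eq_zero_or_pos m with rfl | hm
  · simp [pois, hl]
  have hm' : (1 : ℝ) ≤ m := by exact_mod_cast hm
  have h1 := Stirling.le_factorial_stirling m
  have h2 : l ^ m * Real.exp (-l) ≤ (m / Real.exp 1) ^ m := by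
    have h3 : l / m ≤ Real.exp (l / m - 1) := by
      have := Real.add_one_le_exp (l / m - 1); linarith
    have h4 : (l / m) ^ m ≤ Real.exp (l - m) := by
      calc (l / m) ^ m ≤ Real.exp (l / m - 1) ^ m := by gcongr
        _ = Real.exp (l - m) := by
          rw [← Real.exp_nat_mul]; congr 1; field_simp
    rw [div_pow, ← Real.exp_nat_mul, mul_one, le_div_iff₀ (by positivity)]
    rw [div_pow, div_le_iff₀ (by positivity)] at h4
    calc l ^ m * Real.exp (-l) * Real.exp m ≤
        Real.exp (l - m) * m ^ m * Real.exp (-l) * Real.exp m := by gcongr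
      _ = m ^ m * (Real.exp (l - m) * Real.exp (-l) * Real.exp m) := by ring
      _ = m ^ m := by
          rw [← Real.exp_add, ← Real.exp_add, show l - (m : ℝ) + -l + m = 0 by ring,
            Real.exp_zero, mul_one]
  have h5 : √((m : ℝ) + 1) ≤ √(2 * Real.pi * m) := by
    apply Real.sqrt_le_sqrt
    nlinarith [Real.pi_gt_three]
  have hq : 0 < √((m : ℝ) + 1) := Real.sqrt_pos.2 (by positivity)
  unfold pois
  rw [le_div_iff₀ hq, mul_div_assoc', div_mul_eq_mul_div, div_le_one (by positivity)]
  calc Real.exp (-l) * l ^ m * √((m : ℝ) + 1) ≤ (m / Real.exp 1) ^ m * √(2 * Real.pi * m) := by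
        rw [mul_comm (Real.exp (-l))]; gcongr
    _ ≤ _ := by rw [mul_comm]; exact h1

lemma factorial_le_stirling {k : ℕ} (hk : k ≠ 0) :
    (k.factorial : ℝ) ≤ Real.exp 1 * √((k : ℝ) + 1) * (k / Real.exp 1) ^ k := by
  obtain ⟨n, rfl⟩ := Nat.exists_eq_succ_of_ne_zero hk
  have h := Stirling.stirlingSeq'_antitone (Nat.zero_le n)
  simp only [Function.comp] at h
  rw [show Nat.succ 0 = 1 from rfl, Stirling.stirlingSeq_one, Stirling.stirlingSeq] at h
  rw [div_le_iff₀ (by positivity)] at h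
  refine h.trans (le_of_eq_of_le (b := Real.exp 1 * √(n.succ : ℝ) *
    ((n.succ : ℝ) / Real.exp 1) ^ n.succ) ?_ ?_)
  · rw [Real.sqrt_mul (by norm_num)]
    field_simp
  · gcongr; simp

/-- The weight `∏ r_j ^ α_j / α_j!`. -/
def mw {d : ℕ} (r : Fin d → ℝ) (α : Fin d → ℕ) : ℝ := ∏ j, r j ^ α j / (α j).factorial

lemma mw_nonneg {d : ℕ} {r : Fin d → ℝ} (hr : ∀ j, 0 ≤ r j) (α : Fin d → ℕ) : 0 ≤ mw r α :=
  Finset.prod_nonneg fun j _ => div_nonneg (pow_nonneg (hr j) _) (Nat.cast_nonneg _)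

lemma sum_piAntidiag_prod_div_factorial {𝕜 : Type*} [Field 𝕜] [CharZero 𝕜] {d : ℕ} (u : Fin d → 𝕜)
    (k : ℕ) : ∑ α ∈ Finset.piAntidiag Finset.univ k, ∏ j, u j ^ α j / ((α j).factorial : 𝕜) =
      (∑ j, u j) ^ k / k.factorial := by
  rw [Finset.sum_pow_eq_sum_piAntidiag, Finset.sum_div]
  refine Finset.sum_congr rfl fun α hα => ?_
  rw [Finset.mem_piAntidiag] at hα
  have h := Nat.multinomial_spec Finset.univ α
  have h' : (∏ i, ((α i).factorial : 𝕜)) * (Nat.multinomial Finset.univ α : 𝕜) =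
      (k.factorial : 𝕜) := by
    rw [← hα.1, ← h]; push_cast; rfl
  have h1 : (∏ i, ((α i).factorial : 𝕜)) ≠ 0 :=
    Finset.prod_ne_zero_iff.2 fun i _ => Nat.cast_ne_zero.2 (Nat.factorial_ne_zero _)
  have h2 : (k.factorial : 𝕜) ≠ 0 := Nat.cast_ne_zero.2 (Nat.factorial_ne_zero _)
  rw [Finset.prod_div_distrib, div_eq_div_iff h1 h2, ← h']
  ring

lemma sum_mw {d : ℕ} (r : Fin d → ℝ) (k : ℕ) :
    ∑ α ∈ Finset.piAntidiag Finset.univ k, mw r α = (∑ j, r j) ^ k / k.factorial :=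
  sum_piAntidiag_prod_div_factorial r k

lemma sum_mw_mul_prod_le {d : ℕ} {r : Fin d → ℝ} (hr : ∀ j, 0 < r j) (k : ℕ) :
    ∑ α ∈ Finset.piAntidiag Finset.univ k, mw r α * ∏ j, (1 / ((α j : ℝ) + 1)) ≤
      (∑ j, r j) ^ k / k.factorial * ((∑ j, r j) ^ d / ∏ j, r j) / ((k : ℝ) + 1) ^ d := by
  have hS : 0 ≤ ∑ j, r j := Finset.sum_nonneg fun j _ => (hr j).le
  have hR : 0 < ∏ j, r j := Finset.prod_pos fun j _ => hr j
  have h1 : ∀ α : Fin d → ℕ, mw r α * ∏ j, (1 / ((α j : ℝ) + 1)) =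
      (∏ j, r j)⁻¹ * mw r (fun j => α j + 1) := by
    intro α
    unfold mw
    rw [← Finset.prod_inv_distrib, ← Finset.prod_mul_distrib, ← Finset.prod_mul_distrib]
    refine Finset.prod_congr rfl fun j _ => ?_
    have := (hr j).ne'
    rw [Nat.factorial_succ, pow_succ]
    push_cast
    field_simp
  have hinj : Function.Injective fun (α : Fin d → ℕ) j => α j + 1 := by
    intro α β h
    funext j
    exact Nat.succ_injective (congrFun h j)
  have h2 : ∑ α ∈ Finset.piAntidiag Finset.univ k, mw r (fun j => α j + 1) ≤
      (∑ j, r j) ^ (k + d) / (k + d).factorial := by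
    rw [← sum_mw, ← Finset.sum_image (f := mw r) (g := fun (α : Fin d → ℕ) j => α j + 1)
      (fun a _ b _ h => hinj h)]
    refine Finset.sum_le_sum_of_subset_of_nonneg ?_ fun α _ _ => mw_nonneg (fun j => (hr j).le) α
    intro β hβ
    obtain ⟨α, hα, rfl⟩ := Finset.mem_image.1 hβ
    rw [Finset.mem_piAntidiag] at hα ⊢
    refine ⟨?_, fun i _ => Finset.mem_univ i⟩
    have : ∑ j, (α j + 1) = k + d := by
      rw [Finset.sum_add_distrib, hα.1]; simp
    exact this
  have h3 : ((k : ℝ) + 1) ^ d * k.factorial ≤ (k + d).factorial := by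
    have := Nat.pow_succ_le_ascFactorial (k + 1) d
    have h4 := Nat.factorial_mul_ascFactorial k d
    have h5 : (k + 1) ^ d * k.factorial ≤ (k + d).factorial := by
      rw [← h4, mul_comm]; gcongr
    exact_mod_cast h5
  simp_rw [h1]
  rw [← Finset.mul_sum]
  calc _ ≤ (∏ j, r j)⁻¹ * ((∑ j, r j) ^ (k + d) / (k + d).factorial) := by gcongr
    _ ≤ (∏ j, r j)⁻¹ * ((∑ j, r j) ^ (k + d) / (((k : ℝ) + 1) ^ d * k.factorial)) := by gcongr
    _ = _ := by rw [pow_add]; field_simp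

lemma mw_le {d : ℕ} {r : Fin d → ℝ} (hr : ∀ j, 0 < r j) (hS : 0 < ∑ j, r j) {k : ℕ}
    {α : Fin d → ℕ} (hα : ∑ j, α j = k) :
    mw r α ≤ (∑ j, r j) ^ k / k.factorial * (Real.exp 1 * √((k : ℝ) + 1)) *
      ∏ j, (1 / √((α j : ℝ) + 1)) := by
  rcases Nat.eq_zero_or_pos k with rfl | hk
  · have h0 : ∀ j, α j = 0 := by
      intro j
      exact (Finset.sum_eq_zero_iff.1 hα) j (Finset.mem_univ j)
    simp [mw, h0]
  have hk' : (0 : ℝ) < k := by exact_mod_cast hk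
  set S := ∑ j, r j with hSdef
  set t : ℝ := k / S with ht
  have htp : 0 < t := by positivity
  have h1 : mw r α * t ^ k ≤ Real.exp k * ∏ j, (1 / √((α j : ℝ) + 1)) := by
    have e1 : mw r α * t ^ k = Real.exp k * ∏ j, pois (r j * t) (α j) := by
      unfold mw pois
      have e3 : Real.exp (k : ℝ) * ∏ j, Real.exp (-(r j * t)) = 1 := by
        rw [← Real.exp_sum, ← Real.exp_add, Finset.sum_neg_distrib, ← Finset.sum_mul, ← hSdef, ht,
          mul_div_cancel₀ _ hS.ne']
        simp
      rw [Finset.prod_mul_distrib, ← mul_assoc, e3, one_mul, ← hα, ← Finset.prod_pow_eq_pow_sum,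
        ← Finset.prod_mul_distrib]
      refine Finset.prod_congr rfl fun j _ => ?_
      rw [mul_pow]; ring
    rw [e1]
    gcongr with j
    · intro j _
      exact pois_nonneg (mul_nonneg (hr j).le htp.le) _
    · exact pois_le_one_div_sqrt (mul_nonneg (hr j).le htp.le) _
  have h2 : Real.exp k ≤ S ^ k / k.factorial * (Real.exp 1 * √((k : ℝ) + 1)) * t ^ k := by
    have := factorial_le_stirling hk.ne'
    have e2 : S ^ k * t ^ k = (k : ℝ) ^ k := by rw [← mul_pow, ht, mul_div_cancel₀ _ hS.ne']
    rw [div_pow, ← Real.exp_nat_mul, mul_one, mul_div_assoc', le_div_iff₀ (by positivity)] at this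
    calc Real.exp k ≤ Real.exp 1 * √((k : ℝ) + 1) * (k : ℝ) ^ k / k.factorial := by
          rw [le_div_iff₀ (by positivity)]; linarith
      _ = _ := by rw [← e2]; ring
  have hP : 0 ≤ ∏ j, (1 / √((α j : ℝ) + 1)) := Finset.prod_nonneg fun j _ => by positivity
  refine le_of_mul_le_mul_right ?_ (pow_pos htp k)
  calc mw r α * t ^ k ≤ Real.exp k * ∏ j, (1 / √((α j : ℝ) + 1)) := h1
    _ ≤ (S ^ k / k.factorial * (Real.exp 1 * √((k : ℝ) + 1)) * t ^ k) *
        ∏ j, (1 / √((α j : ℝ) + 1)) := by gcongr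
    _ = _ := by ring

/-- The collision probability of a multinomial distribution with `k` trials and `e + 1` outcomes is
`O(k ^ (-e / 2))`. -/
lemma exists_sum_mw_sq_le {d e : ℕ} (hde : d = e + 1) {r : Fin d → ℝ} (hr : ∀ j, 0 < r j)
    (hS : 0 < ∑ j, r j) :
    ∃ C : ℝ, 0 < C ∧ ∀ k : ℕ, ∑ α ∈ Finset.piAntidiag Finset.univ k, mw r α ^ 2 ≤
      ((∑ j, r j) ^ k / k.factorial) ^ 2 * (C / √(((k : ℝ) + 1) ^ e)) := by
  set S := ∑ j, r j with hSdef
  set A := S ^ d / ∏ j, r j with hA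
  have hR : 0 < ∏ j, r j := Finset.prod_pos fun j _ => hr j
  have hA0 : 0 < A := by positivity
  refine ⟨Real.exp 1 * √A, by positivity, fun k => ?_⟩
  set E := S ^ k / k.factorial with hE
  have hE0 : 0 < E := by positivity
  have hmw := mw_nonneg (fun j => (hr j).le)
  have hP : ∀ α : Fin d → ℕ, 0 ≤ ∏ j, (1 / ((α j : ℝ) + 1)) := fun α =>
    Finset.prod_nonneg fun j _ => by positivity
  have hPs : ∀ α : Fin d → ℕ, ∏ j, (1 / √((α j : ℝ) + 1)) = √(∏ j, (1 / ((α j : ℝ) + 1))) := by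
    intro α
    rw [Real.sqrt_prod _ (fun j _ => by positivity)]
    refine Finset.prod_congr rfl fun j _ => ?_
    rw [Real.sqrt_div (by norm_num), Real.sqrt_one]
  have hcs : ∑ α ∈ Finset.piAntidiag Finset.univ k, mw r α * ∏ j, (1 / √((α j : ℝ) + 1)) ≤
      √E * √(E * A / ((k : ℝ) + 1) ^ d) := by
    calc _ = ∑ α ∈ Finset.piAntidiag Finset.univ k,
          √(mw r α) * √(mw r α * ∏ j, (1 / ((α j : ℝ) + 1))) := by
          refine Finset.sum_congr rfl fun α _ => ?_
          rw [hPs, Real.sqrt_mul (hmw α), ← mul_assoc, Real.mul_self_sqrt (hmw α)]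
      _ ≤ √(∑ α ∈ Finset.piAntidiag Finset.univ k, mw r α) *
          √(∑ α ∈ Finset.piAntidiag Finset.univ k, mw r α * ∏ j, (1 / ((α j : ℝ) + 1))) :=
          Real.sum_sqrt_mul_sqrt_le _ (fun α => hmw α) (fun α => mul_nonneg (hmw α) (hP α))
      _ ≤ _ := by
          rw [sum_mw]
          gcongr
          exact sum_mw_mul_prod_le hr k
  calc ∑ α ∈ Finset.piAntidiag Finset.univ k, mw r α ^ 2
      ≤ ∑ α ∈ Finset.piAntidiag Finset.univ k, E * (Real.exp 1 * √((k : ℝ) + 1)) *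
        (mw r α * ∏ j, (1 / √((α j : ℝ) + 1))) := by
        refine Finset.sum_le_sum fun α hα => ?_
        have := mw_le hr hS (Finset.mem_piAntidiag.1 hα).1
        rw [pow_two]
        calc mw r α * mw r α ≤ mw r α * _ := mul_le_mul_of_nonneg_left this (hmw α)
          _ = _ := by ring
    _ ≤ E * (Real.exp 1 * √((k : ℝ) + 1)) * (√E * √(E * A / ((k : ℝ) + 1) ^ d)) := by
        rw [← Finset.mul_sum]; gcongr
    _ = _ := by
        clear_value E A
        rw [Real.sqrt_div (by positivity), Real.sqrt_mul hE0.le, hde, pow_succ,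
          Real.sqrt_mul (by positivity)]
        have h1 : √E * √E = E := Real.mul_self_sqrt hE0.le
        have h2 : √((k : ℝ) + 1) ≠ 0 := (Real.sqrt_pos.2 (by positivity)).ne'
        have h3 : √(((k : ℝ) + 1) ^ e) ≠ 0 := (Real.sqrt_pos.2 (by positivity)).ne'
        field_simp
        rw [show √E ^ 2 = E by rw [pow_two]; exact h1]

/-! ### Elements of `ℋ²` and operators given by their rows -/

lemma memlp_two_iff {ι : Type*} {f : ι → ℂ} :
    Memℓp (E := fun _ => ℂ) f 2 ↔ Summable fun i => ‖f i‖ ^ 2 := by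
  rw [memℓp_gen_iff (by norm_num)]
  norm_num

lemma lp_two_summable_sq {ι : Type*} (x : lp (fun _ : ι => ℂ) 2) : Summable fun i => ‖x i‖ ^ 2 :=
  memlp_two_iff.1 (lp.memℓp x)

lemma lp_two_norm_sq {ι : Type*} (x : lp (fun _ : ι => ℂ) 2) : ‖x‖ ^ 2 = ∑' i, ‖x i‖ ^ 2 := by
  have := lp.norm_rpow_eq_tsum (p := 2) (by norm_num) x
  norm_num at this
  exact this

lemma lp_two_norm_le {ι : Type*} {x : lp (fun _ : ι => ℂ) 2} {C : ℝ} (hC : 0 ≤ C)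
    (h : ∀ s : Finset ι, ∑ i ∈ s, ‖x i‖ ^ 2 ≤ C ^ 2) : ‖x‖ ≤ C := by
  refine lp.norm_le_of_forall_sum_le (by norm_num) hC fun s => ?_
  norm_num
  exact h s

lemma lp_two_sum_le {ι : Type*} (x : lp (fun _ : ι => ℂ) 2) (s : Finset ι) :
    ∑ i ∈ s, ‖x i‖ ^ 2 ≤ ‖x‖ ^ 2 := by
  rw [lp_two_norm_sq]
  exact (lp_two_summable_sq x).sum_le_tsum s fun i _ => by positivity

lemma exists_clm_of_rows {ι E : Type*} [NormedAddCommGroup E] [InnerProductSpace ℂ E] (Φ : ι → E)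
    {C : ℝ} (hC : 0 ≤ C)
    (h : ∀ (x : E) (s : Finset ι), ∑ i ∈ s, ‖inner ℂ (Φ i) x‖ ^ 2 ≤ (C * ‖x‖) ^ 2) :
    ∃ T : E →L[ℂ] lp (fun _ : ι => ℂ) 2, (∀ x i, T x i = inner ℂ (Φ i) x) ∧ ‖T‖ ≤ C := by
  have hm : ∀ x, Memℓp (E := fun _ : ι => ℂ) (fun i => inner ℂ (Φ i) x) 2 := fun x =>
    memlp_two_iff.2 (summable_of_sum_le (fun i => by positivity) (h x))
  let L : E →ₗ[ℂ] lp (fun _ : ι => ℂ) 2 :=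
    { toFun := fun x => ⟨fun i => inner ℂ (Φ i) x, hm x⟩
      map_add' := fun x y => by ext i; exact inner_add_right _ _ _
      map_smul' := fun c x => by ext i; exact inner_smul_right _ _ _ }
  have hL : ∀ x, ‖L x‖ ≤ C * ‖x‖ := fun x => lp_two_norm_le (by positivity) (h x)
  exact ⟨L.mkContinuous C hL, fun x i => rfl, L.mkContinuous_norm_le hC hL⟩

lemma norm_natCast_cpow_neg_sq (c : ℂ) (n : ℕ+) :
    ‖((n : ℕ) : ℂ) ^ (-c)‖ ^ 2 = 1 / n * Real.exp (-((2 * c.re - 1) * Real.log n)) := by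
  have hn : (0 : ℝ) < n := by exact_mod_cast n.pos
  rw [Complex.norm_natCast_cpow_of_pos n.pos, neg_re, ← Real.rpow_natCast, ← Real.rpow_mul hn.le,
    show (1 : ℝ) / n = n ^ (-1 : ℝ) by rw [Real.rpow_neg_one, one_div], Real.rpow_def_of_pos hn,
    Real.rpow_def_of_pos hn, ← Real.exp_add]
  congr 1; push_cast; ring

lemma memlp_cpow_mul_eval {c : ℂ} (hc : 1 / 2 < c.re) (p : Polynomial ℂ) :
    Memℓp (E := fun _ : ℕ+ => ℂ) (fun n : ℕ+ =>
      (starRingEnd ℂ) (((n : ℕ) : ℂ) ^ (-c)) * p.eval ((Real.log n : ℝ) : ℂ)) 2 := by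
  induction p using Polynomial.induction_on' with
  | add p q hp hq =>
    have := hp.add hq
    convert this using 1
    funext n
    simp [mul_add]
  | monomial k a =>
    rw [memlp_two_iff]
    set S := 2 * c.re - 1 with hS
    have hS0 : 0 < S := by rw [hS]; linarith
    have := ((summable_pois_log_div hS0 (2 * k)).1.mul_left
      (‖a‖ ^ 2 * ((2 * k).factorial / S ^ (2 * k))))
    refine this.congr fun n => ?_
    rw [norm_mul, mul_pow, RCLike.norm_conj, norm_natCast_cpow_neg_sq, Polynomial.eval_monomial,
      norm_mul, norm_pow, Complex.norm_real, Real.norm_of_nonneg (log_pnat_nonneg n)]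
    unfold pois
    rw [← hS]
    field_simp
    rw [mul_pow]; ring

/-- The element of `ℋ²` with coefficients `conj (n ^ (-c)) * p (log n)`. -/
def polyVec {c : ℂ} (hc : 1 / 2 < c.re) : Polynomial ℂ →ₗ[ℂ] H2 where
  toFun p := ⟨_, memlp_cpow_mul_eval hc p⟩
  map_add' p q := by
    ext n
    simp [mul_add]
    rfl
  map_smul' a p := by
    ext n
    simp [mul_left_comm]

lemma polyVec_apply {c : ℂ} (hc : 1 / 2 < c.re) (p : Polynomial ℂ) (n : ℕ+) :
    polyVec hc p n = (starRingEnd ℂ) (((n : ℕ) : ℂ) ^ (-c)) * p.eval ((Real.log n : ℝ) : ℂ) := rfl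

/-- The element of `ℋ²` with coefficients `conj (n ^ (-c)) * (log n) ^ k`. -/
def logVec {c : ℂ} (hc : 1 / 2 < c.re) (k : ℕ) : H2 := polyVec hc (Polynomial.X ^ k)

lemma logVec_apply {c : ℂ} (hc : 1 / 2 < c.re) (k : ℕ) (n : ℕ+) :
    logVec hc k n = (starRingEnd ℂ) (((n : ℕ) : ℂ) ^ (-c)) * ((Real.log n : ℝ) : ℂ) ^ k := by
  rw [logVec, polyVec_apply, Polynomial.eval_X_pow]

lemma hasSum_inner_logVec {c : ℂ} (hc : 1 / 2 < c.re) (k : ℕ) (x : H2) :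
    HasSum (fun n : ℕ+ => x n * (((n : ℕ) : ℂ) ^ (-c) * ((Real.log n : ℝ) : ℂ) ^ k))
      (inner ℂ (logVec hc k) x) := by
  refine (lp.hasSum_inner (logVec hc k) x).congr_fun fun n => ?_
  rw [logVec_apply, RCLike.inner_apply, map_mul, Complex.conj_conj, map_pow, Complex.conj_ofReal]

lemma summable_pois_mul_norm_sq {S : ℝ} (hS : 0 ≤ S) (k : ℕ) (x : H2) :
    Summable fun n : ℕ+ => pois (S * Real.log n) k * ‖x n‖ ^ 2 := by
  refine Summable.of_nonneg_of_le (fun n => mul_nonneg (pois_nonneg ?_ k) (by positivity))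
    (fun n => mul_le_of_le_one_left (by positivity) ?_) (lp_two_summable_sq x)
  · exact mul_nonneg hS (log_pnat_nonneg n)
  · simpa using sum_pois_le_one (mul_nonneg hS (log_pnat_nonneg n)) {k}

lemma sum_tsum_pois_mul_norm_sq_le {S : ℝ} (hS : 0 ≤ S) (x : H2) (s : Finset ℕ) :
    ∑ k ∈ s, ∑' n : ℕ+, pois (S * Real.log n) k * ‖x n‖ ^ 2 ≤ ‖x‖ ^ 2 := by
  rw [← Summable.tsum_finsetSum fun k _ => summable_pois_mul_norm_sq hS k x, lp_two_norm_sq]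
  refine Summable.tsum_le_tsum (fun n => ?_)
    (summable_sum fun k _ => summable_pois_mul_norm_sq hS k x) (lp_two_summable_sq x)
  rw [← Finset.sum_mul]
  exact mul_le_of_le_one_left (by positivity)
    (sum_pois_le_one (mul_nonneg hS (log_pnat_nonneg n)) s)

lemma norm_inner_logVec_sq_le {c : ℂ} {S : ℝ} (hS : 0 < S) (hc : 1 / 2 < c.re)
    (hcS : c.re = 1 / 2 + S) (k : ℕ) (x : H2) :
    (S ^ k / k.factorial) ^ 2 * ‖inner ℂ (logVec hc k) x‖ ^ 2 ≤
      (2 * Real.exp (S * Real.log 2) / S) * ∑' n : ℕ+, pois (S * Real.log n) k * ‖x n‖ ^ 2 := by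
  obtain ⟨hs1, hs2⟩ := summable_pois_log_div hS k
  have hs3 := summable_pois_mul_norm_sq hS.le k x
  have hp : ∀ n : ℕ+, 0 ≤ pois (S * Real.log n) k := fun n =>
    pois_nonneg (mul_nonneg hS.le (log_pnat_nonneg n)) k
  set f : ℕ+ → ℝ := fun n => √(pois (S * Real.log n) k / n) with hf
  set g : ℕ+ → ℝ := fun n => √(pois (S * Real.log n) k * ‖x n‖ ^ 2) with hg
  have hf2 : ∀ n, f n ^ (2 : ℝ) = pois (S * Real.log n) k / n := fun n => by
    rw [Real.rpow_two]; exact Real.sq_sqrt (div_nonneg (hp n) (by positivity))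
  have hg2 : ∀ n, g n ^ (2 : ℝ) = pois (S * Real.log n) k * ‖x n‖ ^ 2 := fun n => by
    rw [Real.rpow_two]; exact Real.sq_sqrt (mul_nonneg (hp n) (by positivity))
  have hH := Real.summable_and_inner_le_Lp_mul_Lq_tsum_of_nonneg (f := f) (g := g)
    Real.HolderConjugate.two_two (fun n => Real.sqrt_nonneg _) (fun n => Real.sqrt_nonneg _)
    (by simpa only [hf2] using hs1) (by simpa only [hg2] using hs3)
  simp only [hf2, hg2] at hH
  rw [← Real.sqrt_eq_rpow, ← Real.sqrt_eq_rpow] at hH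
  have hfg : ∀ n : ℕ+, (S ^ k / k.factorial) *
      ‖x n * (((n : ℕ) : ℂ) ^ (-c) * ((Real.log n : ℝ) : ℂ) ^ k)‖ = f n * g n := by
    intro n
    have h0 : ‖((n : ℕ) : ℂ) ^ (-c)‖ = √(1 / n) * Real.exp (-(S * Real.log n)) := by
      rw [← Real.sqrt_sq (norm_nonneg (((n : ℕ) : ℂ) ^ (-c))), norm_natCast_cpow_neg_sq,
        Real.sqrt_mul (by positivity), ← Real.sqrt_sq (Real.exp_nonneg (-(S * Real.log n))),
        ← Real.exp_nat_mul]
      congr 3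
      rw [hcS]; push_cast; ring
    have h1 : f n * g n = √(1 / n) * pois (S * Real.log n) k * ‖x n‖ := by
      simp only [hf, hg]
      rw [div_eq_mul_one_div, Real.sqrt_mul (hp n), Real.sqrt_mul (hp n),
        Real.sqrt_sq (norm_nonneg _)]
      have := Real.mul_self_sqrt (hp n)
      linear_combination (√(1 / n) * ‖x n‖) * this
    rw [h1, norm_mul, norm_mul, h0, norm_pow, Complex.norm_real,
      Real.norm_of_nonneg (log_pnat_nonneg n)]
    unfold pois
    rw [mul_pow]; ring
  have hE : 0 < S ^ k / k.factorial := by positivity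
  have hsum : Summable fun n : ℕ+ =>
      ‖x n * (((n : ℕ) : ℂ) ^ (-c) * ((Real.log n : ℝ) : ℂ) ^ k)‖ := by
    have := hH.1.mul_left (S ^ k / k.factorial)⁻¹
    refine this.congr fun n => ?_
    rw [← hfg n]; field_simp
  have hle : (S ^ k / k.factorial) * ‖inner ℂ (logVec hc k) x‖ ≤ ∑' n, f n * g n := by
    rw [← (hasSum_inner_logVec hc k x).tsum_eq]
    calc _ ≤ (S ^ k / k.factorial) *
          ∑' n : ℕ+, ‖x n * (((n : ℕ) : ℂ) ^ (-c) * ((Real.log n : ℝ) : ℂ) ^ k)‖ := by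
          gcongr; exact norm_tsum_le_tsum_norm hsum
      _ = _ := by rw [← tsum_mul_left]; exact tsum_congr hfg
  have hA : 0 ≤ ∑' n : ℕ+, pois (S * Real.log n) k / n := tsum_nonneg fun n =>
    div_nonneg (hp n) (by positivity)
  have hB : 0 ≤ ∑' n : ℕ+, pois (S * Real.log n) k * ‖x n‖ ^ 2 := tsum_nonneg fun n =>
    mul_nonneg (hp n) (by positivity)
  calc _ = ((S ^ k / k.factorial) * ‖inner ℂ (logVec hc k) x‖) ^ 2 := by rw [mul_pow]
    _ ≤ (√(∑' n : ℕ+, pois (S * Real.log n) k / n) *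
        √(∑' n : ℕ+, pois (S * Real.log n) k * ‖x n‖ ^ 2)) ^ 2 := by
        exact pow_le_pow_left₀ (by positivity) (hle.trans hH.2) 2
    _ = (∑' n : ℕ+, pois (S * Real.log n) k / n) *
        ∑' n : ℕ+, pois (S * Real.log n) k * ‖x n‖ ^ 2 := by
        rw [mul_pow, Real.sq_sqrt hA, Real.sq_sqrt hB]
    _ ≤ _ := by gcongr

/-! ### The matrix of the composition operator -/

/-- The coefficient of `∏ z_j ^ α_j` in `exp (-∑ a_j z_j)`. -/
def expCoeff {d : ℕ} (a : Fin d → ℂ) (α : Fin d → ℕ) : ℂ := ∏ j, (-a j) ^ α j / (α j).factorial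

lemma norm_expCoeff {d : ℕ} (a : Fin d → ℂ) (α : Fin d → ℕ) :
    ‖expCoeff a α‖ = mw (fun j => ‖a j‖) α := by
  simp [expCoeff, mw, norm_prod]

/-- The row of index `α` of the matrix of the composition operator. -/
def rowVec {d : ℕ} (a : Fin d → ℂ) {c : ℂ} (hc : 1 / 2 < c.re) (α : Fin d → ℕ) : H2 :=
  (starRingEnd ℂ) (expCoeff a α) • logVec hc (∑ j, α j)

lemma inner_rowVec {d : ℕ} (a : Fin d → ℂ) {c : ℂ} (hc : 1 / 2 < c.re) (α : Fin d → ℕ) (x : H2) :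
    inner ℂ (rowVec a hc α) x = expCoeff a α * inner ℂ (logVec hc (∑ j, α j)) x := by
  rw [rowVec, inner_smul_left, Complex.conj_conj]

lemma sum_le_sum_piAntidiag {d : ℕ} {F : (Fin d → ℕ) → ℝ} (hF : ∀ α, 0 ≤ F α)
    (s : Finset (Fin d → ℕ))
    {A : Finset ℕ} (hA : ∀ α ∈ s, ∑ j, α j ∈ A) :
    ∑ α ∈ s, F α ≤ ∑ k ∈ A, ∑ α ∈ Finset.piAntidiag Finset.univ k, F α := by
  rw [← Finset.sum_fiberwise_of_maps_to hA]
  refine Finset.sum_le_sum fun k _ => Finset.sum_le_sum_of_subset_of_nonneg ?_ fun α _ _ => hF α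
  intro α hα
  rw [Finset.mem_filter] at hα
  exact Finset.mem_piAntidiag.2 ⟨hα.2, fun i _ => Finset.mem_univ i⟩

lemma exists_sum_norm_inner_rowVec_sq_le {d e : ℕ} (hde : d = e + 1) {a : Fin d → ℂ}
    (ha : ∀ j, a j ≠ 0) {c : ℂ} (hc : 1 / 2 < c.re) (hcS : c.re = 1 / 2 + ∑ j, ‖a j‖) :
    ∃ C : ℝ, 0 < C ∧ ∀ (I : ℕ), 1 ≤ I → ∀ (x : H2) (s : Finset (Fin d → ℕ)),
      (∀ α ∈ s, I ^ 2 ≤ ∑ j, α j + 1) →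
      ∑ α ∈ s, ‖inner ℂ (rowVec a hc α) x‖ ^ 2 ≤ C / (I : ℝ) ^ e * ‖x‖ ^ 2 := by
  have hS : 0 < ∑ j, ‖a j‖ := by linarith
  obtain ⟨C, hC, hCk⟩ := exists_sum_mw_sq_le hde (r := fun j => ‖a j‖)
    (fun j => norm_pos_iff.2 (ha j)) hS
  set S := ∑ j, ‖a j‖
  set D := 2 * Real.exp (S * Real.log 2) / S with hD
  have hD0 : 0 < D := by positivity
  refine ⟨C * D, by positivity, fun I hI x s hs => ?_⟩
  have hI' : (0 : ℝ) < I := by exact_mod_cast hI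
  set E : ℕ → ℝ := fun k => ∑' n : ℕ+, pois (S * Real.log n) k * ‖x n‖ ^ 2 with hE
  have hE0 : ∀ k, 0 ≤ E k := fun k => tsum_nonneg fun n =>
    mul_nonneg (pois_nonneg (mul_nonneg hS.le (log_pnat_nonneg n)) k) (by positivity)
  set A := s.image fun α => ∑ j, α j with hA
  calc ∑ α ∈ s, ‖inner ℂ (rowVec a hc α) x‖ ^ 2
      ≤ ∑ k ∈ A, ∑ α ∈ Finset.piAntidiag Finset.univ k, ‖inner ℂ (rowVec a hc α) x‖ ^ 2 :=
        sum_le_sum_piAntidiag (fun α => by positivity) s fun α hα => Finset.mem_image_of_mem _ hα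
    _ = ∑ k ∈ A, (∑ α ∈ Finset.piAntidiag Finset.univ k, mw (fun j => ‖a j‖) α ^ 2) *
        ‖inner ℂ (logVec hc k) x‖ ^ 2 := by
        refine Finset.sum_congr rfl fun k _ => ?_
        rw [Finset.sum_mul]
        refine Finset.sum_congr rfl fun α hα => ?_
        rw [inner_rowVec, norm_mul, mul_pow, norm_expCoeff, (Finset.mem_piAntidiag.1 hα).1]
    _ ≤ ∑ k ∈ A, C * D / (I : ℝ) ^ e * E k := by
        refine Finset.sum_le_sum fun k hk => ?_
        have hIk : I ^ 2 ≤ k + 1 := by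
          obtain ⟨α, hα, rfl⟩ := Finset.mem_image.1 hk
          exact hs α hα
        have h1 : (I : ℝ) ^ e ≤ √(((k : ℝ) + 1) ^ e) := by
          apply Real.le_sqrt_of_sq_le
          rw [← pow_mul, mul_comm e 2, pow_mul]
          gcongr
          exact_mod_cast hIk
        calc _ ≤ ((S ^ k / k.factorial) ^ 2 * (C / √(((k : ℝ) + 1) ^ e))) *
              ‖inner ℂ (logVec hc k) x‖ ^ 2 := by gcongr; exact hCk k
          _ = (C / √(((k : ℝ) + 1) ^ e)) *
              ((S ^ k / k.factorial) ^ 2 * ‖inner ℂ (logVec hc k) x‖ ^ 2) := by ring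
          _ ≤ (C / (I : ℝ) ^ e) * (D * E k) := by
              exact mul_le_mul (by gcongr) (norm_inner_logVec_sq_le hS hc hcS k x) (by positivity)
                (by positivity)
          _ = _ := by ring
    _ ≤ C * D / (I : ℝ) ^ e * ‖x‖ ^ 2 := by
        rw [← Finset.mul_sum]
        gcongr
        exact sum_tsum_pois_mul_norm_sq_le hS.le x A

lemma hasSum_prod_pow_div_factorial {𝕜 : Type*} [RCLike 𝕜] {d : ℕ} (u : Fin d → 𝕜) :
    (Summable fun α : Fin d → ℕ => ‖∏ j, u j ^ α j / ((α j).factorial : 𝕜)‖) ∧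
      HasSum (fun α : Fin d → ℕ => ∏ j, u j ^ α j / ((α j).factorial : 𝕜))
        (NormedSpace.exp (∑ j, u j)) := by
  induction d with
  | zero =>
    refine ⟨Summable.of_finite, ?_⟩
    simp
  | succ d ih =>
    obtain ⟨ih1, ih2⟩ := ih fun j => u j.succ
    have h1 : Summable fun k : ℕ => ‖u 0 ^ k / (k.factorial : 𝕜)‖ :=
      NormedSpace.norm_expSeries_div_summable (u 0)
    have h2 := NormedSpace.expSeries_div_hasSum_exp (u 0)
    have h3 := h1.mul_norm ih1
    have h4 := h2.mul ih2 h3.of_norm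
    rw [← NormedSpace.exp_add] at h4
    constructor
    · rw [← (Fin.consEquiv fun _ => ℕ).summable_iff]
      refine h3.congr fun x => ?_
      simp [Fin.consEquiv, Fin.prod_univ_succ, -Finset.prod_div_distrib]
    · rw [← (Fin.consEquiv fun _ => ℕ).hasSum_iff, Fin.sum_univ_succ]
      refine h4.congr_fun fun x => ?_
      simp [Fin.consEquiv, Fin.prod_univ_succ, -Finset.prod_div_distrib]

/-- The integer `∏ q_j ^ α_j`. -/
def qmap {d : ℕ} {q : Fin d → ℕ} (hq : ∀ j, 2 ≤ q j) (α : Fin d → ℕ) : ℕ+ :=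
  ⟨∏ j, q j ^ α j, Finset.prod_pos fun j _ => pow_pos (by have := hq j; omega) _⟩

lemma qmap_injective {d : ℕ} {q : Fin d → ℕ} (hq : ∀ j, 2 ≤ q j) (hind : MultIndep q) :
    Function.Injective (qmap hq) := fun α β h => hind α β (congrArg Subtype.val h)

lemma qmap_cpow {d : ℕ} {q : Fin d → ℕ} (hq : ∀ j, 2 ≤ q j) (α : Fin d → ℕ) (s : ℂ) :
    ((qmap hq α : ℕ) : ℂ) ^ s = ∏ j, ((q j : ℂ) ^ s) ^ α j := by
  have h1 : ∀ t : Finset (Fin d), ((∏ j ∈ t, q j ^ α j : ℕ) : ℂ) ^ s =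
      ∏ j ∈ t, ((q j : ℂ) ^ s) ^ α j := by
    intro t
    induction t using Finset.induction_on with
    | empty => simp
    | insert j t hj ih =>
      rw [Finset.prod_insert hj, Finset.prod_insert hj, Nat.cast_mul, natCast_mul_natCast_cpow, ih]
      congr 1
      generalize α j = k
      induction k with
      | zero => simp
      | succ k ihk => rw [pow_succ, Nat.cast_mul, natCast_mul_natCast_cpow, ihk, pow_succ]
  exact h1 Finset.univ

/-- An operator whose entries at the indices `qmap α` are given by `rowVec`. -/
def HasRows {d : ℕ} {q : Fin d → ℕ} (hq : ∀ j, 2 ≤ q j) (a : Fin d → ℂ) {c : ℂ}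
    (hc : 1 / 2 < c.re) (T : H2 →L[ℂ] H2) : Prop :=
  (∀ x α, T x (qmap hq α) = inner ℂ (rowVec a hc α) x) ∧
    ∀ x, ∀ m ∉ Set.range (qmap hq), T x m = 0

lemma exists_hasRows {d : ℕ} (hd : 1 ≤ d) {q : Fin d → ℕ} (hq : ∀ j, 2 ≤ q j)
    (hind : MultIndep q) {a : Fin d → ℂ} (ha : ∀ j, a j ≠ 0) {c : ℂ} (hc : 1 / 2 < c.re)
    (hcS : c.re = 1 / 2 + ∑ j, ‖a j‖) : ∃ T : H2 →L[ℂ] H2, HasRows hq a hc T := by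
  obtain ⟨e, rfl⟩ : ∃ e, d = e + 1 := ⟨d - 1, by omega⟩
  have hinj := qmap_injective hq hind
  obtain ⟨C, hC, hT⟩ := exists_sum_norm_inner_rowVec_sq_le rfl ha hc hcS
  obtain ⟨T, hT, -⟩ := exists_clm_of_rows (Function.extend (qmap hq) (rowVec a hc) 0)
    (Real.sqrt_nonneg C) fun x s => by
      rw [mul_pow, Real.sq_sqrt hC.le, ← Finset.sum_preimage (qmap hq) s hinj.injOn
        (fun m => ‖inner ℂ (Function.extend (qmap hq) (rowVec a hc) 0 m) x‖ ^ 2)]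
      · simp only [hinj.extend_apply]
        simpa using hT 1 le_rfl x (s.preimage _ hinj.injOn) (fun α _ => by simp)
      · intro m _ hm
        rw [Function.extend_apply' _ _ _ (by simpa using hm)]
        simp
  refine ⟨T, fun x α => ?_, fun x m hm => ?_⟩
  · rw [hT, hinj.extend_apply]
  · rw [hT, Function.extend_apply' _ _ _ (by simpa using hm)]
    simp

lemma HasRows.isCompOp {d : ℕ} [NeZero d] {q : Fin d → ℕ} {hq : ∀ j, 2 ≤ q j}
    (hind : MultIndep q) {a : Fin d → ℂ} (ha : ∀ j, a j ≠ 0) {c : ℂ} {hc : 1 / 2 < c.re}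
    (hcS : c.re = 1 / 2 + ∑ j, ‖a j‖) {T : H2 →L[ℂ] H2} (hT : HasRows hq a hc T) :
    IsCompOp (fun s => c + ∑ j, a j * (q j : ℂ) ^ (-s)) T := by
  intro x s hs
  have hinj := qmap_injective hq hind
  set u : Fin d → ℂ := fun j => -a j * (q j : ℂ) ^ (-s) with hu
  have hlog : ∀ n : ℕ+, (0 : ℝ) ≤ Real.log n := log_pnat_nonneg
  have hS' : ∑ j, ‖u j‖ < ∑ j, ‖a j‖ := by
    refine Finset.sum_lt_sum_of_nonempty Finset.univ_nonempty fun j _ => ?_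
    rw [hu, norm_mul, norm_neg, Complex.norm_natCast_cpow_of_pos (by have := hq j; omega)]
    refine mul_lt_of_lt_one_right (norm_pos_iff.2 (ha j))
      (Real.rpow_lt_one_of_one_lt_of_neg (by exact_mod_cast hq j) ?_)
    rw [neg_re]; linarith
  set F : ℕ+ → (Fin d → ℕ) → ℂ := fun n α => x n * ((n : ℕ) : ℂ) ^ (-c) *
    ∏ j, (u j * (Real.log n : ℝ)) ^ α j / ((α j).factorial : ℂ) with hF
  have hn : ∀ n : ℕ+, HasSum (F n) (x n * (n : ℂ) ^ (-(c + ∑ j, a j * (q j : ℂ) ^ (-s)))) := by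
    intro n
    have h0 : ((n : ℕ) : ℂ) ≠ 0 := by exact_mod_cast n.ne_zero
    have := ((hasSum_prod_pow_div_factorial fun j => u j * (Real.log n : ℝ)).2).mul_left
      (x n * ((n : ℕ) : ℂ) ^ (-c))
    rw [← Complex.exp_eq_exp_ℂ] at this
    have hv : ((n : ℕ) : ℂ) ^ (-(c + ∑ j, a j * (q j : ℂ) ^ (-s))) =
        ((n : ℕ) : ℂ) ^ (-c) * Complex.exp (∑ j, u j * (Real.log n : ℝ)) := by
      rw [neg_add, cpow_add _ _ h0, cpow_def_of_ne_zero h0 (-∑ j, _), ← Finset.sum_mul,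
        mul_comm (∑ j, u j),
        ← Finset.sum_neg_distrib, Complex.natCast_log]
      simp [hu]
    rw [hv, ← mul_assoc]
    exact this
  have hG : ∀ n : ℕ+, HasSum (fun α => ‖F n α‖)
      (‖x n‖ * (‖((n : ℕ) : ℂ) ^ (-c)‖ * Real.exp ((∑ j, ‖u j‖) * Real.log n))) := by
    intro n
    have := ((hasSum_prod_pow_div_factorial fun j => ‖u j‖ * Real.log n).2).mul_left
      (‖x n‖ * ‖((n : ℕ) : ℂ) ^ (-c)‖)
    rw [← Real.exp_eq_exp_ℝ, ← Finset.sum_mul, mul_assoc] at this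
    refine this.congr_fun fun α => ?_
    simp [hF, norm_prod, abs_of_nonneg (hlog n), -Complex.natCast_log]
  have hFs : Summable (Function.uncurry fun n α => F n α) := by
    rw [← summable_norm_iff, summable_prod_of_nonneg (fun _ => norm_nonneg _)]
    refine ⟨fun n => (hG n).summable, ?_⟩
    simp only [Function.uncurry, (hG _).tsum_eq]
    obtain ⟨δ, hδ⟩ : ∃ δ, δ = 2 * (∑ j, ‖a j‖ - ∑ j, ‖u j‖) := ⟨_, rfl⟩
    have hδ0 : 0 < δ := by rw [hδ]; linarith
    have h2 := (summable_pois_log_div hδ0 0).1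
    refine Summable.of_nonneg_of_le (fun n => by positivity) (fun n => ?_)
      ((lp_two_summable_sq x).add h2)
    have h3 : pois (δ * Real.log n) 0 / n =
        (‖((n : ℕ) : ℂ) ^ (-c)‖ * Real.exp ((∑ j, ‖u j‖) * Real.log n)) ^ 2 := by
      rw [mul_pow, norm_natCast_cpow_neg_sq, mul_assoc, ← Real.exp_nat_mul, ← Real.exp_add]
      simp only [pois, pow_zero, Nat.factorial_zero, Nat.cast_one, div_one, mul_one]
      rw [div_eq_inv_mul, one_div, hcS, hδ]
      congr 2; push_cast; ring
    rw [h3]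
    nlinarith [sq_nonneg (‖x n‖ - ‖((n : ℕ) : ℂ) ^ (-c)‖ * Real.exp ((∑ j, ‖u j‖) * Real.log n)),
      sq_nonneg ‖x n‖, sq_nonneg (‖((n : ℕ) : ℂ) ^ (-c)‖ * Real.exp ((∑ j, ‖u j‖) * Real.log n))]
  have hα : ∀ α, ∑' n, F n α = T x (qmap hq α) * ((qmap hq α : ℕ) : ℂ) ^ (-s) := by
    intro α
    rw [hT.1, inner_rowVec, ← (hasSum_inner_logVec hc _ x).tsum_eq, ← tsum_mul_left,
      ← tsum_mul_right]
    refine tsum_congr fun n => ?_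
    simp only [hF, hu, expCoeff, mul_pow, Finset.prod_div_distrib, Finset.prod_mul_distrib,
      qmap_cpow,
      Finset.prod_pow_eq_pow_sum]
    ring
  calc H2series (T x) s = ∑' α, T x (qmap hq α) * ((qmap hq α : ℕ) : ℂ) ^ (-s) := by
        refine (hinj.tsum_eq (f := fun n : ℕ+ => T x n * ((n : ℕ) : ℂ) ^ (-s)) ?_).symm
        intro m hm
        by_contra h
        exact hm (by simp [hT.2 x m h])
    _ = ∑' α, ∑' n, F n α := tsum_congr fun α => (hα α).symm
    _ = ∑' n, ∑' α, F n α := hFs.tsum_comm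
    _ = _ := tsum_congr fun n => (hn n).tsum_eq

/-! ### Polynomial approximation of monomials -/

lemma mul_exp_le_inv_mul_exp {z c : ℝ} (hc : 0 < c) :
    z * Real.exp (-(c * (z - 1))) ≤ Real.exp (c - 1) / c := by
  have h := Real.add_one_le_exp (c * z - 1)
  rw [le_div_iff₀ hc, mul_right_comm]
  calc z * c * Real.exp (-(c * (z - 1))) ≤ Real.exp (c * z - 1) * Real.exp (-(c * (z - 1))) := by
        gcongr; linarith
    _ = Real.exp (c - 1) := by rw [← Real.exp_add]; ring_nf

lemma one_add_mul_exp_neg_mul_exp_abs_le {x y : ℝ} (hy0 : 0 ≤ y) (hy : y ≤ 1 / 2) :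
    (1 + x) * Real.exp (-x) * Real.exp (y * |x|) ≤ Real.exp (y ^ 2) := by
  rw [mul_assoc, ← Real.exp_add]
  rcases le_total 0 x with hx | hx
  · have h := mul_exp_le_inv_mul_exp (z := 1 + x) (show (0 : ℝ) < 1 - y by linarith)
    rw [abs_of_nonneg hx, show -x + y * x = -((1 - y) * (1 + x - 1)) by ring]
    refine h.trans ?_
    rw [div_le_iff₀ (by linarith)]
    have h1 := Real.quadratic_le_exp_of_nonneg (show 0 ≤ y + y ^ 2 by positivity)
    have h2 : 1 ≤ Real.exp (y + y ^ 2) * (1 - y) := by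
      refine le_trans ?_ (mul_le_mul_of_nonneg_right h1 (by linarith))
      nlinarith [mul_nonneg (sq_nonneg y)
        (show 0 ≤ 1 - y - y ^ 2 - y ^ 3 by nlinarith [sq_nonneg y])]
    calc Real.exp (1 - y - 1) = Real.exp (-y) * 1 := by rw [mul_one]; ring_nf
      _ ≤ Real.exp (-y) * (Real.exp (y + y ^ 2) * (1 - y)) := by gcongr
      _ = Real.exp (y ^ 2) * (1 - y) := by rw [← mul_assoc, ← Real.exp_add]; ring_nf
  · have h := mul_exp_le_inv_mul_exp (z := 1 + x) (show (0 : ℝ) < 1 + y by linarith)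
    rw [abs_of_nonpos hx, show -x + y * -x = -((1 + y) * (1 + x - 1)) by ring]
    refine h.trans ?_
    rw [div_le_iff₀ (by linarith)]
    have h1 := Real.add_one_le_exp (y ^ 2 - y)
    have h2 : 1 ≤ Real.exp (y ^ 2 - y) * (1 + y) := by
      refine le_trans ?_ (mul_le_mul_of_nonneg_right h1 (by linarith))
      nlinarith [pow_nonneg hy0 3]
    calc Real.exp (1 + y - 1) = Real.exp y * 1 := by rw [mul_one]; ring_nf
      _ ≤ Real.exp y * (Real.exp (y ^ 2 - y) * (1 + y)) := by gcongr
      _ = Real.exp (y ^ 2) * (1 + y) := by rw [← mul_assoc, ← Real.exp_add]; ring_nf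

lemma sum_choose_mul_abs_pow_le (j M : ℕ) (x : ℝ) :
    ∑ m ∈ (Finset.range (j + 1)).filter (M ≤ ·), (j.choose m : ℝ) * |x| ^ m ≤
      Real.exp (2 * j * |x|) / 2 ^ M := by
  rw [le_div_iff₀ (by positivity), Finset.sum_mul]
  calc ∑ m ∈ (Finset.range (j + 1)).filter (M ≤ ·), (j.choose m : ℝ) * |x| ^ m * 2 ^ M
      ≤ ∑ m ∈ (Finset.range (j + 1)).filter (M ≤ ·), (j.choose m : ℝ) * |x| ^ m * 2 ^ m := by
        refine Finset.sum_le_sum fun m hm => ?_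
        gcongr
        · norm_num
        · exact (Finset.mem_filter.1 hm).2
    _ ≤ ∑ m ∈ Finset.range (j + 1), (j.choose m : ℝ) * |x| ^ m * 2 ^ m :=
        Finset.sum_le_sum_of_subset_of_nonneg (Finset.filter_subset _ _) fun m _ _ => by positivity
    _ = (2 * |x| + 1) ^ j := by
        rw [add_pow]
        refine Finset.sum_congr rfl fun m _ => ?_
        rw [mul_pow, one_pow]; ring
    _ ≤ Real.exp (2 * |x|) ^ j := by gcongr; exact Real.add_one_le_exp _
    _ = _ := by rw [← Real.exp_nat_mul]; ring_nf

lemma pois_mul_pow_mul_exp_le {S t : ℝ} (hS : 0 < S) (ht : 0 ≤ t) {i j M : ℕ} (hj : j ≤ 2 * i)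
    (hi : 10 ≤ i) :
    S ^ (i ^ 2 + j) / (i ^ 2 + j).factorial * (t ^ i ^ 2 *
      ∑ m ∈ (Finset.range (j + 1)).filter (M ≤ ·),
        (j.choose m : ℝ) * (i ^ 2 / S) ^ (j - m) * |t - i ^ 2 / S| ^ m) *
      Real.exp (-(S * t)) * (1 + t) ≤ (1 + i ^ 2 / S) * Real.exp 25 / 2 ^ M := by
  have hi0 : (10 : ℝ) ≤ i := by exact_mod_cast hi
  set τ : ℝ := i ^ 2 / S with hτ
  have hτ0 : 0 < τ := by positivity
  have hSτ : S * τ = i ^ 2 := by rw [hτ]; field_simp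
  obtain ⟨x, hx⟩ : ∃ x, t = τ * (1 + x) := ⟨t / τ - 1, by field_simp; ring⟩
  have hx1 : 0 ≤ 1 + x := by
    rw [hx] at ht
    exact nonneg_of_mul_nonneg_right ht hτ0
  have h1 : ∑ m ∈ (Finset.range (j + 1)).filter (M ≤ ·),
      (j.choose m : ℝ) * τ ^ (j - m) * |t - τ| ^ m ≤ τ ^ j * (Real.exp (2 * j * |x|) / 2 ^ M) := by
    refine le_trans (le_of_eq ?_)
      (mul_le_mul_of_nonneg_left (sum_choose_mul_abs_pow_le j M x) (by positivity))
    rw [Finset.mul_sum]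
    refine Finset.sum_congr rfl fun m hm => ?_
    have hm' : m ≤ j := by
      have := Finset.mem_range.1 (Finset.mem_filter.1 hm).1
      omega
    rw [hx, show τ * (1 + x) - τ = τ * x by ring, abs_mul, abs_of_pos hτ0, mul_pow,
      ← pow_sub_mul_pow τ hm']
    ring
  have h2 : 1 + t ≤ (1 + τ) * Real.exp |x| := by
    have h3 := Real.add_one_le_exp |x|
    have h4 := le_abs_self x
    have h5 := abs_nonneg x
    calc 1 + t ≤ (1 + τ) * (|x| + 1) := by rw [hx]; nlinarith
      _ ≤ _ := by gcongr
  have h3 : (S * τ) ^ (i ^ 2 + j) / (i ^ 2 + j).factorial * Real.exp (-(S * τ)) ≤ 1 := by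
    have := sum_pois_le_one (show 0 ≤ S * τ by positivity) {i ^ 2 + j}
    rw [Finset.sum_singleton, pois] at this
    linarith
  have h4 : (1 + x) ^ i ^ 2 * Real.exp (-(S * τ * x)) * Real.exp (2 * j * |x|) * Real.exp |x| ≤
      Real.exp 25 := by
    have h5 := one_add_mul_exp_neg_mul_exp_abs_le (x := x) (y := 5 / i) (by positivity)
      (by rw [div_le_div_iff₀ (by positivity) (by norm_num)]; linarith)
    have h6 := pow_le_pow_left₀ (by positivity) h5 (i ^ 2)
    rw [mul_pow, mul_pow, ← Real.exp_nat_mul, ← Real.exp_nat_mul, ← Real.exp_nat_mul] at h6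
    push_cast at h6
    have h7 : (i : ℝ) ^ 2 * (5 / i) ^ 2 = 25 := by field_simp; norm_num
    rw [h7] at h6
    refine le_trans ?_ h6
    rw [mul_assoc _ (Real.exp (2 * j * |x|)), ← Real.exp_add, hSτ, mul_neg]
    gcongr
    have h8 : (j : ℝ) ≤ 2 * i := by exact_mod_cast hj
    have h9 : (i : ℝ) ^ 2 * (5 / i * |x|) = 5 * i * |x| := by field_simp
    rw [h9]
    nlinarith [abs_nonneg x]
  calc _ ≤ S ^ (i ^ 2 + j) / (i ^ 2 + j).factorial * (t ^ i ^ 2 *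
          (τ ^ j * (Real.exp (2 * j * |x|) / 2 ^ M))) *
          Real.exp (-(S * t)) * ((1 + τ) * Real.exp |x|) := by gcongr
    _ = ((S * τ) ^ (i ^ 2 + j) / (i ^ 2 + j).factorial * Real.exp (-(S * τ))) *
          ((1 + x) ^ i ^ 2 * Real.exp (-(S * τ * x)) * Real.exp (2 * j * |x|) * Real.exp |x|) *
          ((1 + τ) / 2 ^ M) := by
        rw [hx, show -(S * (τ * (1 + x))) = -(S * τ) + -(S * τ * x) by ring,
          Real.exp_add, mul_pow S,
          mul_pow τ, pow_add τ]
        ring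
    _ ≤ 1 * Real.exp 25 * ((1 + τ) / 2 ^ M) := by gcongr
    _ = _ := by ring

open Polynomial in
lemma exists_polynomial_approx {S : ℝ} (hS : 0 < S) {i j M : ℕ} (hj : j ≤ 2 * i) (hM : 20 ≤ M) :
    ∃ p ∈ Submodule.span ℂ ((fun m => (X : ℂ[X]) ^ i ^ 2 * (X - C ((i ^ 2 / S : ℝ) : ℂ)) ^ m) ''
        (Set.Iio M)), ∀ t : ℝ, 0 ≤ t →
      S ^ (i ^ 2 + j) / (i ^ 2 + j).factorial * ‖(X ^ (i ^ 2 + j) - p).eval (t : ℂ)‖ *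
        Real.exp (-(S * t)) * (1 + t) ≤ (1 + i ^ 2 / S) * Real.exp 25 / 2 ^ M := by
  set τ : ℝ := i ^ 2 / S with hτ
  have hτ0 : 0 ≤ τ := by positivity
  set w : ℕ → ℂ[X] := fun m => ((j.choose m : ℂ) * (τ : ℂ) ^ (j - m)) •
    (X ^ i ^ 2 * (X - C (τ : ℂ)) ^ m) with hw
  have hX : (X : ℂ[X]) ^ (i ^ 2 + j) = ∑ m ∈ Finset.range (j + 1), w m := by
    conv_lhs => rw [pow_add, show (X : ℂ[X]) ^ j = ((X - C (τ : ℂ)) + C (τ : ℂ)) ^ j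
      by ring, add_pow,
      Finset.mul_sum]
    refine Finset.sum_congr rfl fun m _ => ?_
    simp only [hw, smul_eq_C_mul, map_mul, map_pow, map_natCast]
    ring
  refine ⟨∑ m ∈ (Finset.range (j + 1)).filter (¬ M ≤ ·), w m, ?_, fun t ht => ?_⟩
  · refine Submodule.sum_mem _ fun m hm => Submodule.smul_mem _ _ (Submodule.subset_span ?_)
    exact ⟨m, by simpa using (Finset.mem_filter.1 hm).2, rfl⟩
  · have hsub : (X : ℂ[X]) ^ (i ^ 2 + j) - ∑ m ∈ (Finset.range (j + 1)).filter (¬ M ≤ ·), w m =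
        ∑ m ∈ (Finset.range (j + 1)).filter (M ≤ ·), w m := by
      rw [hX, ← Finset.sum_filter_add_sum_filter_not (Finset.range (j + 1))
        (M ≤ ·), add_sub_cancel_right]
    have hnorm : ‖(∑ m ∈ (Finset.range (j + 1)).filter (M ≤ ·), w m).eval (t : ℂ)‖ ≤
        t ^ i ^ 2 * ∑ m ∈ (Finset.range (j + 1)).filter (M ≤ ·),
          (j.choose m : ℝ) * τ ^ (j - m) * |t - τ| ^ m := by
      rw [eval_finsetSum, Finset.mul_sum]
      refine (norm_sum_le _ _).trans (Finset.sum_le_sum fun m _ => le_of_eq ?_)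
      simp only [hw, eval_smul, eval_mul, eval_pow, eval_X, eval_sub, eval_C, smul_eq_mul, norm_mul,
        norm_pow, Complex.norm_natCast, Complex.norm_real, ← Complex.ofReal_sub, Real.norm_eq_abs,
        abs_of_nonneg ht, abs_of_nonneg hτ0]
      ring
    rw [hsub]
    rcases le_or_gt 10 i with hi | hi
    · refine le_trans ?_ (pois_mul_pow_mul_exp_le hS ht hj hi)
      gcongr
    · rw [Finset.filter_false_of_mem (fun m hm => by have := Finset.mem_range.1 hm; omega)]
      simp only [Finset.sum_empty, eval_zero, norm_zero, mul_zero, zero_mul]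
      positivity

/-! ### Approximation numbers -/

section ApproxNumber

variable {E F : Type*} [NormedAddCommGroup E] [NormedSpace ℂ E] [NormedAddCommGroup F]
  [NormedSpace ℂ F]

lemma approxNumber_nonneg (T : E →L[ℂ] F) (n : ℕ) : 0 ≤ approxNumber T n :=
  Real.sInf_nonneg (by rintro _ ⟨R, -, -, rfl⟩; exact norm_nonneg _)

lemma approxNumber_le {T R : E →L[ℂ] F} {n : ℕ}
    (hf : FiniteDimensional ℂ (LinearMap.range (R : E →ₗ[ℂ] F)))
    (hn : Module.finrank ℂ (LinearMap.range (R : E →ₗ[ℂ] F)) < n) : approxNumber T n ≤ ‖T - R‖ :=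
  csInf_le ⟨0, by rintro _ ⟨R, -, -, rfl⟩; exact norm_nonneg _⟩ ⟨R, hf, hn, rfl⟩

lemma le_approxNumber {T : E →L[ℂ] F} {n : ℕ} {b : ℝ} (h : ∀ R : E →L[ℂ] F,
    FiniteDimensional ℂ (LinearMap.range (R : E →ₗ[ℂ] F)) →
    Module.finrank ℂ (LinearMap.range (R : E →ₗ[ℂ] F)) ≤ n → b ≤ ‖T - R‖) :
    b ≤ approxNumber T (n + 1) := by
  refine le_csInf ⟨_, 0, ?_, ?_, rfl⟩ ?_
  · rw [ContinuousLinearMap.toLinearMap_zero, LinearMap.range_zero]; infer_instance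
  · rw [ContinuousLinearMap.toLinearMap_zero, LinearMap.range_zero, finrank_bot]; omega
  · rintro _ ⟨R, hf, hn, rfl⟩
    exact h R hf (by omega)

lemma approxNumber_antitone (T : E →L[ℂ] F) : Antitone fun n => approxNumber T (n + 1) :=
  fun _ _ hmn => le_approxNumber fun _ hf hn => approxNumber_le hf (by omega)

end ApproxNumber

lemma approxNumber_le_of_orthogonal {E F : Type*} [NormedAddCommGroup E] [InnerProductSpace ℂ E]
    [NormedAddCommGroup F] [NormedSpace ℂ F] (T : E →L[ℂ] F) (V : Submodule ℂ E)
    [FiniteDimensional ℂ V] {n : ℕ} (hn : Module.finrank ℂ V ≤ n) {C : ℝ} (hC : 0 ≤ C)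
    (h : ∀ y, (∀ v ∈ V, inner ℂ v y = 0) → ‖T y‖ ≤ C * ‖y‖) : approxNumber T (n + 1) ≤ C := by
  set R : E →L[ℂ] F := T ∘L V.starProjection with hR
  have hle : LinearMap.range (R : E →ₗ[ℂ] F) ≤ V.map (T : E →ₗ[ℂ] F) := by
    rintro _ ⟨x, rfl⟩
    exact ⟨V.starProjection x, V.starProjection_apply_mem x, rfl⟩
  have hf : FiniteDimensional ℂ (LinearMap.range (R : E →ₗ[ℂ] F)) :=
    Submodule.finiteDimensional_of_le hle
  refine (approxNumber_le hf ?_).trans (ContinuousLinearMap.opNorm_le_bound _ hC fun x => ?_)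
  · exact Nat.lt_succ_of_le
      ((Submodule.finrank_mono hle).trans ((Submodule.finrank_map_le _ _).trans hn))
  · have h1 : (T - R) x = T (x - V.starProjection x) := by simp [hR]
    have h2 : ‖x - V.starProjection x‖ ≤ ‖x‖ := by
      rw [← Submodule.starProjection_orthogonal_val]
      exact Submodule.norm_starProjection_apply_le _ x
    rw [h1]
    refine (h _ fun v hv => ?_).trans (by gcongr)
    rw [← inner_conj_symm, Submodule.starProjection_inner_eq_zero x v hv, map_zero]

/-! ### The upper bound -/

lemma exists_norm_polyVec_le {c : ℂ} {S : ℝ} (hc : 1 / 2 < c.re) (hcS : c.re = 1 / 2 + S) :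
    ∃ Z : ℝ, 0 ≤ Z ∧ ∀ (p : Polynomial ℂ) (A : ℝ), 0 ≤ A → (∀ t : ℝ, 0 ≤ t →
      ‖p.eval (t : ℂ)‖ * Real.exp (-(S * t)) * (1 + t) ≤ A) → ‖polyVec hc p‖ ≤ Z * A := by
  refine ⟨√(∑' n : ℕ+, 1 / ((n : ℝ) * (1 + Real.log n) ^ 2)), Real.sqrt_nonneg _,
    fun p A hA h => lp_two_norm_le (by positivity) fun s => ?_⟩
  rw [mul_pow, Real.sq_sqrt (tsum_nonneg fun n => by positivity)]
  calc ∑ n ∈ s, ‖polyVec hc p n‖ ^ 2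
      ≤ ∑ n ∈ s, 1 / ((n : ℝ) * (1 + Real.log n) ^ 2) * A ^ 2 := by
        refine Finset.sum_le_sum fun n _ => ?_
        have hl := log_pnat_nonneg n
        have hn : (0 : ℝ) < n := by exact_mod_cast n.pos
        have h1 := pow_le_pow_left₀ (by positivity) (h _ hl) 2
        have h2 : Real.exp (-(S * Real.log n)) ^ 2 =
            Real.exp (-((2 * c.re - 1) * Real.log n)) := by
          rw [← Real.exp_nat_mul, hcS]; congr 1; push_cast; ring
        rw [mul_pow, mul_pow, h2] at h1
        rw [polyVec_apply, norm_mul, mul_pow, RCLike.norm_conj, norm_natCast_cpow_neg_sq,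
          one_div_mul_eq_div, one_div_mul_eq_div, div_mul_eq_mul_div,
          div_le_div_iff₀ hn (by positivity)]
        nlinarith
    _ ≤ _ := by
        rw [← Finset.sum_mul]
        gcongr
        exact summable_one_div_mul_log_sq.sum_le_tsum s fun n _ => by positivity

lemma exists_submodule_approx {c : ℂ} {S : ℝ} (hS : 0 < S) (hc : 1 / 2 < c.re)
    (hcS : c.re = 1 / 2 + S) : ∃ Z : ℝ, 0 ≤ Z ∧ ∀ I M : ℕ, 1 ≤ I → 20 ≤ M →
      ∃ V : Submodule ℂ H2, FiniteDimensional ℂ V ∧ Module.finrank ℂ V ≤ I * M ∧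
        ∀ k < I ^ 2, ∃ v ∈ V, S ^ k / k.factorial * ‖logVec hc k - v‖ ≤ Z * I ^ 2 / 2 ^ M := by
  obtain ⟨Z, hZ, hZp⟩ := exists_norm_polyVec_le hc hcS
  refine ⟨Z * ((1 + 1 / S) * Real.exp 25), by positivity, fun I M hI hM => ?_⟩
  classical
  set g : ℕ × ℕ → H2 := fun x => polyVec hc (Polynomial.X ^ x.1 ^ 2 *
    (Polynomial.X - Polynomial.C ((x.1 ^ 2 / S : ℝ) : ℂ)) ^ x.2) with hg
  set G : Finset H2 := (Finset.range I ×ˢ Finset.range M).image g with hG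
  refine ⟨Submodule.span ℂ (G : Set H2), inferInstance, ?_, fun k hk => ?_⟩
  · refine (finrank_span_finset_le_card G).trans (Finset.card_image_le.trans ?_)
    rw [Finset.card_product, Finset.card_range, Finset.card_range]
  · obtain ⟨i, j, hj, hiI, rfl⟩ : ∃ i j, j ≤ 2 * i ∧ i < I ∧ k = i ^ 2 + j := by
      have h1 := Nat.sqrt_le k
      have h2 := Nat.sqrt_le_add k
      refine ⟨k.sqrt, k - k.sqrt * k.sqrt, by omega, ?_, by rw [sq]; omega⟩
      exact Nat.sqrt_lt'.2 hk
    obtain ⟨p, hp, hpt⟩ := exists_polynomial_approx hS hj hM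
    refine ⟨polyVec hc p, ?_, ?_⟩
    · have := Submodule.mem_map_of_mem (f := polyVec hc) hp
      rw [Submodule.map_span] at this
      refine Submodule.span_mono ?_ this
      rintro _ ⟨_, ⟨m, hm, rfl⟩, rfl⟩
      exact Finset.mem_coe.2 (Finset.mem_image.2
        ⟨(i, m), Finset.mk_mem_product (Finset.mem_range.2 hiI) (Finset.mem_range.2 hm), rfl⟩)
    · set κ : ℝ := S ^ (i ^ 2 + j) / (i ^ 2 + j).factorial with hκ
      have hκ0 : 0 < κ := by positivity
      have h1 := hZp (Polynomial.X ^ (i ^ 2 + j) - p) ((1 + i ^ 2 / S) * Real.exp 25 / 2 ^ M / κ)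
        (by positivity) fun t ht => by
          rw [le_div_iff₀ hκ0]
          refine le_trans (le_of_eq ?_) (hpt t ht)
          ring
      rw [map_sub] at h1
      have hi : (i : ℝ) ≤ I := by exact_mod_cast hiI.le
      have hI' : (1 : ℝ) ≤ I := by exact_mod_cast hI
      calc κ * ‖logVec hc (i ^ 2 + j) - polyVec hc p‖
          ≤ κ * (Z * ((1 + i ^ 2 / S) * Real.exp 25 / 2 ^ M / κ)) := by gcongr; exact h1
        _ = Z * ((1 + i ^ 2 / S) * Real.exp 25) / 2 ^ M := by field_simp
        _ ≤ Z * ((I ^ 2 + I ^ 2 / S) * Real.exp 25) / 2 ^ M := by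
            gcongr
            exact one_le_pow₀ hI'
        _ = _ := by ring

lemma sum_norm_inner_rowVec_sq_le {d : ℕ} {a : Fin d → ℂ} {c : ℂ} (hc : 1 / 2 < c.re) {N : ℕ}
    {y : H2} {ε : ℝ}
    (h : ∀ k < N, (∑ j, ‖a j‖) ^ k / k.factorial * ‖inner ℂ (logVec hc k) y‖ ≤ ε)
    (s : Finset (Fin d → ℕ)) (hs : ∀ α ∈ s, ∑ j, α j < N) :
    ∑ α ∈ s, ‖inner ℂ (rowVec a hc α) y‖ ^ 2 ≤ N * ε ^ 2 := by
  set S := ∑ j, ‖a j‖ with hS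
  have hS0 : 0 ≤ S := Finset.sum_nonneg fun j _ => norm_nonneg _
  calc ∑ α ∈ s, ‖inner ℂ (rowVec a hc α) y‖ ^ 2
      ≤ ∑ k ∈ Finset.range N, ∑ α ∈ Finset.piAntidiag Finset.univ k,
          ‖inner ℂ (rowVec a hc α) y‖ ^ 2 :=
        sum_le_sum_piAntidiag (fun α => by positivity) s fun α hα => Finset.mem_range.2 (hs α hα)
    _ ≤ ∑ k ∈ Finset.range N, ε ^ 2 := by
        refine Finset.sum_le_sum fun k hk => ?_
        have h1 : ∑ α ∈ Finset.piAntidiag Finset.univ k, mw (fun j => ‖a j‖) α ^ 2 ≤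
            (S ^ k / k.factorial) ^ 2 := by
          rw [hS, ← sum_mw]
          exact Finset.sum_sq_le_sq_sum_of_nonneg fun α _ => mw_nonneg (fun j => norm_nonneg _) α
        calc _ = (∑ α ∈ Finset.piAntidiag Finset.univ k, mw (fun j => ‖a j‖) α ^ 2) *
              ‖inner ℂ (logVec hc k) y‖ ^ 2 := by
              rw [Finset.sum_mul]
              refine Finset.sum_congr rfl fun α hα => ?_
              rw [inner_rowVec, norm_mul, mul_pow, norm_expCoeff, (Finset.mem_piAntidiag.1 hα).1]
          _ ≤ (S ^ k / k.factorial) ^ 2 * ‖inner ℂ (logVec hc k) y‖ ^ 2 := by gcongr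
          _ ≤ ε ^ 2 := by
              rw [← mul_pow]
              exact pow_le_pow_left₀ (by positivity) (h k (Finset.mem_range.1 hk)) 2
    _ = _ := by simp

lemma HasRows.sum_norm_sq {d : ℕ} {q : Fin d → ℕ} {hq : ∀ j, 2 ≤ q j} (hind : MultIndep q)
    {a : Fin d → ℂ} {c : ℂ} {hc : 1 / 2 < c.re} {T : H2 →L[ℂ] H2} (hT : HasRows hq a hc T) (x : H2)
    (s : Finset ℕ+) : ∃ t : Finset (Fin d → ℕ), (∀ α ∈ t, qmap hq α ∈ s) ∧
      ∑ m ∈ s, ‖T x m‖ ^ 2 = ∑ α ∈ t, ‖inner ℂ (rowVec a hc α) x‖ ^ 2 := by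
  refine ⟨s.preimage (qmap hq) (qmap_injective hq hind).injOn, fun α => by simp, ?_⟩
  rw [← Finset.sum_preimage (qmap hq) s (qmap_injective hq hind).injOn (fun m => ‖T x m‖ ^ 2)]
  · exact Finset.sum_congr rfl fun α _ => by rw [hT.1]
  · intro m _ hm
    rw [hT.2 x m hm]
    simp

lemma HasRows.exists_approxNumber_sq_le {d e : ℕ} (hde : d = e + 1) {q : Fin d → ℕ}
    {hq : ∀ j, 2 ≤ q j} (hind : MultIndep q) {a : Fin d → ℂ} (ha : ∀ j, a j ≠ 0) {c : ℂ}
    {hc : 1 / 2 < c.re} (hcS : c.re = 1 / 2 + ∑ j, ‖a j‖) {T : H2 →L[ℂ] H2}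
    (hT : HasRows hq a hc T) :
    ∃ K : ℝ, 0 ≤ K ∧ ∀ I M : ℕ, 1 ≤ I → 20 ≤ M →
      approxNumber T (I * M + 1) ^ 2 ≤ K * (I ^ 6 / 4 ^ M + 1 / I ^ e) := by
  have hS : 0 < ∑ j, ‖a j‖ := by linarith
  obtain ⟨Z, hZ, hV⟩ := exists_submodule_approx hS hc hcS
  obtain ⟨C, hC, htail⟩ := exists_sum_norm_inner_rowVec_sq_le hde ha hc hcS
  refine ⟨Z ^ 2 + C, by positivity, fun I M hI hM => ?_⟩
  obtain ⟨V, hVf, hVr, hVk⟩ := hV I M hI hM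
  have hI' : (1 : ℝ) ≤ I := by exact_mod_cast hI
  set K := (Z ^ 2 + C) * ((I : ℝ) ^ 6 / 4 ^ M + 1 / (I : ℝ) ^ e) with hK
  have hK0 : 0 ≤ K := by positivity
  suffices h : approxNumber T (I * M + 1) ≤ √K by
    calc _ ≤ √K ^ 2 := pow_le_pow_left₀ (approxNumber_nonneg _ _) h 2
      _ = K := Real.sq_sqrt hK0
  refine approxNumber_le_of_orthogonal T V hVr (Real.sqrt_nonneg K) fun y hy =>
    lp_two_norm_le (by positivity) fun s => ?_
  rw [mul_pow, Real.sq_sqrt hK0]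
  obtain ⟨t, -, ht⟩ := hT.sum_norm_sq hind y s
  rw [ht, ← Finset.sum_filter_add_sum_filter_not t fun α => ∑ j, α j < I ^ 2]
  have h1 := sum_norm_inner_rowVec_sq_le (a := a) hc (N := I ^ 2) (y := y)
    (ε := Z * I ^ 2 / 2 ^ M * ‖y‖) (fun k hk => by
      obtain ⟨v, hv, hvk⟩ := hVk k hk
      have h2 : inner ℂ (logVec hc k) y = inner ℂ (logVec hc k - v) y := by
        rw [inner_sub_left, hy v hv, sub_zero]
      rw [h2]
      calc _ ≤ (∑ j, ‖a j‖) ^ k / k.factorial * (‖logVec hc k - v‖ * ‖y‖) := by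
            gcongr; exact norm_inner_le_norm _ _
        _ = (∑ j, ‖a j‖) ^ k / k.factorial * ‖logVec hc k - v‖ * ‖y‖ := by ring
        _ ≤ _ := by gcongr)
    (t.filter fun α => ∑ j, α j < I ^ 2) fun α hα => (Finset.mem_filter.1 hα).2
  have h2 := htail I hI y (t.filter fun α => ¬ ∑ j, α j < I ^ 2) fun α hα => by
    have := (Finset.mem_filter.1 hα).2
    omega
  refine (add_le_add h1 h2).trans ?_
  have h3 : ((I ^ 2 : ℕ) : ℝ) * (Z * I ^ 2 / 2 ^ M * ‖y‖) ^ 2 =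
      Z ^ 2 * (I ^ 6 / 4 ^ M) * ‖y‖ ^ 2 := by
    rw [show (4 : ℝ) = 2 ^ 2 by norm_num, ← pow_mul, mul_comm 2 M, pow_mul]
    push_cast
    field_simp
  rw [h3, hK, ← add_mul]
  gcongr
  have h4 : 0 ≤ (I : ℝ) ^ 6 / 4 ^ M := by positivity
  have h5 : 0 ≤ 1 / (I : ℝ) ^ e := by positivity
  rw [div_eq_mul_one_div C]
  nlinarith [mul_nonneg hC.le h4, mul_nonneg (sq_nonneg Z) h5]

lemma summable_of_antitone_of_le_dyadic {f : ℕ → ℝ} (hf0 : ∀ n, 0 ≤ f n) (hf : Antitone f) (B : ℕ)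
    {K ρ : ℝ} (hρ0 : 0 ≤ ρ) (hρ : 2 * ρ < 1)
    (h : ∀ J, f (2 ^ J * (B * J + 20)) ≤ K * ρ ^ J) : Summable f := by
  set u : ℕ → ℕ := fun J => 2 ^ J * (B * J + 20) with hu
  have hstep : ∀ J, u J + 2 ^ J * (B * J + 2 * B + 20) = u (J + 1) := fun J => by
    simp only [hu]; ring
  have hmono : StrictMono u := strictMono_nat_of_lt_succ fun J => by
    rw [← hstep]
    exact Nat.lt_add_of_pos_right (by positivity)
  set g : ℕ → ℝ := fun J => (B * J + 2 * B + 20) * (2 * ρ) ^ J * K with hg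
  have hgs : Summable g := by
    have hn : ‖2 * ρ‖ < 1 := by rwa [Real.norm_of_nonneg (by positivity)]
    have h1 := (summable_pow_mul_geometric_of_norm_lt_one 1 hn).mul_left (B * K)
    have h2 := (summable_pow_mul_geometric_of_norm_lt_one 0 hn).mul_left ((2 * B + 20) * K)
    refine (h1.add h2).congr fun J => ?_
    simp only [hg]; ring
  have hle : ∀ J, (u (J + 1) - u J) • f (u J) ≤ g J := fun J => by
    rw [← hstep, Nat.add_sub_cancel_left, nsmul_eq_mul]
    push_cast
    calc _ ≤ (2 : ℝ) ^ J * (B * J + 2 * B + 20) * (K * ρ ^ J) := by gcongr; exact h J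
      _ = g J := by simp only [hg, mul_pow]; ring
  have hg0 : ∀ J, 0 ≤ g J := fun J => le_trans (nsmul_nonneg (hf0 _) _) (hle J)
  refine summable_of_sum_range_le (c := ∑ k ∈ Finset.range (u 0), f k + ∑' J, g J) hf0 fun n => ?_
  calc ∑ k ∈ Finset.range n, f k ≤ ∑ k ∈ Finset.range (u n), f k :=
        Finset.sum_le_sum_of_subset_of_nonneg
          (Finset.range_mono (hmono.id_le n)) fun k _ _ => hf0 k
    _ ≤ _ := Finset.le_sum_schlomilch (fun _ _ _ hmn => hf hmn)
      (fun J => by simp only [hu]; positivity)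
        hmono.monotone n
    _ ≤ _ := by
        gcongr
        exact (Finset.sum_le_sum fun J _ => hle J).trans (hgs.sum_le_tsum _ fun J _ => hg0 J)

lemma HasRows.summable_approxNumber {d e : ℕ} (he : 1 ≤ e) (hde : d = e + 1) {q : Fin d → ℕ}
    {hq : ∀ j, 2 ≤ q j} (hind : MultIndep q) {a : Fin d → ℂ} (ha : ∀ j, a j ≠ 0) {c : ℂ}
    {hc : 1 / 2 < c.re} (hcS : c.re = 1 / 2 + ∑ j, ‖a j‖) {T : H2 →L[ℂ] H2}
    (hT : HasRows hq a hc T) {p : ℝ} (hp : 2 / (e : ℝ) < p) :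
    Summable fun n : ℕ => approxNumber T (n + 1) ^ p := by
  have he' : (0 : ℝ) < e := by exact_mod_cast he
  have hp0 : 0 < p := lt_trans (by positivity) hp
  obtain ⟨K, hK, h⟩ := hT.exists_approxNumber_sq_le hde hind ha hcS
  set b : ℝ := (2 : ℝ) ^ (-(e : ℝ) / 2) with hb
  have hb0 : 0 < b := by positivity
  have hbsq : b ^ 2 = 1 / 2 ^ e := by
    rw [hb, ← Real.rpow_natCast, ← Real.rpow_mul (by norm_num), one_div, ← Real.rpow_natCast 2 e,
      ← Real.rpow_neg (by norm_num)]
    congr 1; push_cast; ring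
  refine summable_of_antitone_of_le_dyadic (B := e + 3) (K := √(2 * K) ^ p) (ρ := b ^ p)
    (fun n => Real.rpow_nonneg (approxNumber_nonneg T _) p)
    (fun m n hmn => Real.rpow_le_rpow (approxNumber_nonneg T _) (approxNumber_antitone T hmn)
      hp0.le)
    (by positivity) ?_ fun J => ?_
  · rw [hb, ← Real.rpow_mul (by norm_num)]
    nth_rewrite 1 [← Real.rpow_one 2]
    rw [← Real.rpow_add (by norm_num)]
    apply Real.rpow_lt_one_of_one_lt_of_neg (by norm_num)
    rw [div_lt_iff₀ he'] at hp
    linarith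
  · have h1 := h (2 ^ J) ((e + 3) * J + 20) Nat.one_le_two_pow (by omega)
    have h2 : K * (((2 ^ J : ℕ) : ℝ) ^ 6 / 4 ^ ((e + 3) * J + 20) + 1 / ((2 ^ J : ℕ) : ℝ) ^ e) ≤
        (√(2 * K) * b ^ J) ^ 2 := by
      rw [mul_pow, Real.sq_sqrt (by positivity), ← pow_mul, mul_comm J 2, pow_mul, hbsq,
        mul_comm 2 K,
        mul_assoc]
      gcongr
      rw [two_mul, div_pow, one_pow, ← pow_mul]
      push_cast
      rw [← pow_mul, ← pow_mul, mul_comm J e]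
      refine add_le_add ?_ le_rfl
      rw [div_le_div_iff₀ (by positivity) (by positivity), show (4 : ℝ) = 2 ^ 2 by norm_num,
        ← pow_mul,
        ← pow_add, one_mul]
      exact pow_le_pow_right₀ (by norm_num) (by nlinarith [Nat.zero_le (e * J)])
    have h3 : approxNumber T (2 ^ J * ((e + 3) * J + 20) + 1) ≤ √(2 * K) * b ^ J :=
      le_of_sq_le_sq (h1.trans h2) (by positivity)
    calc _ ≤ (√(2 * K) * b ^ J) ^ p := Real.rpow_le_rpow (approxNumber_nonneg T _) h3 hp0.le
      _ = _ := by
        rw [Real.mul_rpow (by positivity) (by positivity), ← Real.rpow_natCast, ← Real.rpow_natCast,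
          ← Real.rpow_mul hb0.le, ← Real.rpow_mul hb0.le, mul_comm p]

/-! ### Lower bounds for approximation numbers -/

lemma sum_norm_inner_le_of_finrank_le {E F : Type*} [NormedAddCommGroup E] [InnerProductSpace ℂ E]
    [CompleteSpace E] [NormedAddCommGroup F] [InnerProductSpace ℂ F] [CompleteSpace F] {m n : ℕ}
    {x : Fin m → E} {y : Fin m → F} (hx : Orthonormal ℂ x) (hy : Orthonormal ℂ y) (R : E →L[ℂ] F)
    (hf : FiniteDimensional ℂ (LinearMap.range (R : E →ₗ[ℂ] F)))
    (hn : Module.finrank ℂ (LinearMap.range (R : E →ₗ[ℂ] F)) ≤ n) :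
    ∑ i, ‖inner ℂ (y i) (R (x i))‖ ≤ n * ‖R‖ := by
  set b := stdOrthonormalBasis ℂ (LinearMap.range (R : E →ₗ[ℂ] F)) with hb
  have h1 : ∀ i, ‖inner ℂ (y i) (R (x i))‖ ≤
      ∑ k, ‖inner ℂ (x i) (R.adjoint (b k : F))‖ * ‖inner ℂ (y i) (b k : F)‖ := by
    intro i
    have h := congrArg Subtype.val (b.sum_repr' ⟨R (x i), x i, rfl⟩)
    rw [AddSubmonoidClass.coe_finsetSum] at h
    simp only at h
    rw [← h, inner_sum]
    refine (norm_sum_le _ _).trans (Finset.sum_le_sum fun k _ => le_of_eq ?_)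
    rw [Submodule.coe_smul, inner_smul_right, norm_mul, Submodule.coe_inner,
      ContinuousLinearMap.adjoint_inner_right, norm_inner_symm]
  have h2 : ∀ k, ∑ i, ‖inner ℂ (x i) (R.adjoint (b k : F))‖ * ‖inner ℂ (y i) (b k : F)‖ ≤ ‖R‖ := by
    intro k
    have hbk : ‖(b k : F)‖ = 1 := b.orthonormal.1 k
    have h3 := hx.sum_inner_products_le (R.adjoint (b k : F)) (s := Finset.univ)
    have h4 := hy.sum_inner_products_le (b k : F) (s := Finset.univ)
    have h5 : ‖R.adjoint (b k : F)‖ ≤ ‖R‖ := by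
      have := R.adjoint.le_opNorm (b k : F)
      rwa [hbk, mul_one, LinearIsometryEquiv.norm_map] at this
    have h6 := Finset.sum_mul_sq_le_sq_mul_sq Finset.univ
      (fun i => ‖inner ℂ (x i) (R.adjoint (b k : F))‖) fun i => ‖inner ℂ (y i) (b k : F)‖
    refine le_of_sq_le_sq (h6.trans ?_) (norm_nonneg R)
    calc _ ≤ ‖R.adjoint (b k : F)‖ ^ 2 * ‖(b k : F)‖ ^ 2 := by gcongr
      _ ≤ ‖R‖ ^ 2 := by rw [hbk, one_pow, mul_one]; gcongr
  calc ∑ i, ‖inner ℂ (y i) (R (x i))‖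
      ≤ ∑ i, ∑ k, ‖inner ℂ (x i) (R.adjoint (b k : F))‖ * ‖inner ℂ (y i) (b k : F)‖ :=
        Finset.sum_le_sum fun i _ => h1 i
    _ = ∑ k, ∑ i, ‖inner ℂ (x i) (R.adjoint (b k : F))‖ * ‖inner ℂ (y i) (b k : F)‖ :=
        Finset.sum_comm
    _ ≤ ∑ k : Fin (Module.finrank ℂ (LinearMap.range (R : E →ₗ[ℂ] F))), ‖R‖ :=
        Finset.sum_le_sum fun k _ => h2 k
    _ ≤ n * ‖R‖ := by
        rw [Finset.sum_const, Finset.card_univ, Fintype.card_fin, nsmul_eq_mul]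
        gcongr

lemma le_approxNumber_of_orthonormal {E F : Type*} [NormedAddCommGroup E] [InnerProductSpace ℂ E]
    [CompleteSpace E] [NormedAddCommGroup F] [InnerProductSpace ℂ F] [CompleteSpace F] {m n : ℕ}
    {x : Fin m → E} {y : Fin m → F} (hx : Orthonormal ℂ x) (hy : Orthonormal ℂ y) (hnm : n < m)
    {T : E →L[ℂ] F} {P : F →L[ℂ] F} (hP : ‖P‖ ≤ 1)
    (hPy : ∀ i z, inner ℂ (y i) (P z) = inner ℂ (y i) z) {b w : ℝ} (hPT : ‖P ∘L T‖ ≤ b)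
    (hw : ∀ i, w ≤ ‖inner ℂ (y i) (T (x i))‖) (hbw : 2 * (n * b) ≤ m * w) :
    w / 4 ≤ approxNumber T (n + 1) := by
  refine le_approxNumber fun R hf hn => ?_
  set ε := ‖T - R‖ with hε
  have hε0 : 0 ≤ ε := norm_nonneg _
  have hle : LinearMap.range ((P ∘L R : E →L[ℂ] F) : E →ₗ[ℂ] F) ≤
      (LinearMap.range (R : E →ₗ[ℂ] F)).map (P : F →ₗ[ℂ] F) := by
    rintro _ ⟨z, rfl⟩
    exact ⟨R z, ⟨z, rfl⟩, rfl⟩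
  have hf' := Submodule.finiteDimensional_of_le hle
  have h1 := sum_norm_inner_le_of_finrank_le hx hy (P ∘L R) hf'
    (((Submodule.finrank_mono hle).trans (Submodule.finrank_map_le _ _)).trans hn)
  have h2 : ‖P ∘L R‖ ≤ b + ε := by
    have h3 : P ∘L R = P ∘L T - P ∘L (T - R) := by ext z; simp
    rw [h3]
    refine (norm_sub_le _ _).trans (add_le_add hPT ?_)
    refine (ContinuousLinearMap.opNorm_comp_le _ _).trans ?_
    exact mul_le_of_le_one_left hε0 hP
  have h4 : m * w ≤ m * ε + n * (b + ε) := by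
    calc m * w = ∑ _i : Fin m, w := by simp
      _ ≤ ∑ i, (ε + ‖inner ℂ (y i) ((P ∘L R) (x i))‖) := by
          refine Finset.sum_le_sum fun i _ => (hw i).trans ?_
          have h5 : T (x i) = (T - R) (x i) + R (x i) := by simp
          rw [h5, inner_add_right, ContinuousLinearMap.comp_apply, hPy]
          refine (norm_add_le _ _).trans (add_le_add ?_ le_rfl)
          calc _ ≤ ‖y i‖ * ‖(T - R) (x i)‖ := norm_inner_le_norm _ _
            _ ≤ ‖y i‖ * (ε * ‖x i‖) := by gcongr; exact (T - R).le_opNorm _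
            _ = ε := by rw [hx.1 i, hy.1 i]; ring
      _ = m * ε + ∑ i, ‖inner ℂ (y i) ((P ∘L R) (x i))‖ := by
          rw [Finset.sum_add_distrib]; simp
      _ ≤ m * ε + n * ‖P ∘L R‖ := by gcongr
      _ ≤ _ := by gcongr
  have hm : (0 : ℝ) < m := by exact_mod_cast (by omega : 0 < m)
  have hnm' : (n : ℝ) ≤ m := by exact_mod_cast hnm.le
  have h6 : (m : ℝ) * (w / 4) ≤ m * ε := by nlinarith [mul_le_mul_of_nonneg_right hnm' hε0]
  exact le_of_mul_le_mul_left h6 hm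

lemma not_summable_rpow_of_le {f : ℕ → ℝ} {e : ℕ} (he : 1 ≤ e) {K : ℝ} (hK : 0 < K)
    (h : ∀ n : ℕ, K / √(((n : ℝ) + 1) ^ e) ≤ f n) : ¬ Summable fun n => f n ^ (2 / (e : ℝ)) := by
  intro hs
  have he' : (0 : ℝ) < e := by exact_mod_cast he
  have h1 : ∀ n : ℕ, K ^ (2 / (e : ℝ)) * (1 / ((n + 1 : ℕ) : ℝ)) ≤ f n ^ (2 / (e : ℝ)) := by
    intro n
    refine le_trans (le_of_eq ?_) (Real.rpow_le_rpow (by positivity) (h n) (by positivity))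
    rw [Real.div_rpow hK.le (Real.sqrt_nonneg _), Real.sqrt_eq_rpow, ← Real.rpow_natCast,
      ← Real.rpow_mul (by positivity), ← Real.rpow_mul (by positivity),
      show (e : ℝ) * (1 / 2 * (2 / e)) = 1 by field_simp, Real.rpow_one]
    push_cast
    ring
  have h2 : Summable fun n : ℕ => K ^ (2 / (e : ℝ)) * (1 / ((n + 1 : ℕ) : ℝ)) :=
    Summable.of_nonneg_of_le (fun n => by positivity) h1 hs
  rw [summable_mul_left_iff (by positivity), summable_nat_add_iff 1
    (f := fun n : ℕ => 1 / (n : ℝ))] at h2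
  exact Real.not_summable_one_div_natCast h2

/-! ### Finitely supported vectors -/

/-- The vector with coordinates `f n` for `n ∈ X` and `0` elsewhere. -/
def finVec {ι : Type*} (X : Finset ι) (f : ι → ℂ) : lp (fun _ : ι => ℂ) 2 :=
  ⟨fun n => by classical exact if n ∈ X then f n else 0, by
    classical
    exact memlp_two_iff.2 (summable_of_ne_finset_zero (s := X) fun n hn => by simp [hn])⟩

lemma finVec_apply_of_mem {ι : Type*} {X : Finset ι} (f : ι → ℂ) {n : ι} (hn : n ∈ X) :
    finVec X f n = f n := by
  classical
  exact if_pos hn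

lemma finVec_apply_of_notMem {ι : Type*} {X : Finset ι} (f : ι → ℂ) {n : ι} (hn : n ∉ X) :
    finVec X f n = 0 := by
  classical
  exact if_neg hn

lemma norm_finVec_sq {ι : Type*} (X : Finset ι) (f : ι → ℂ) :
    ‖finVec X f‖ ^ 2 = ∑ n ∈ X, ‖f n‖ ^ 2 := by
  rw [lp_two_norm_sq, tsum_eq_sum fun n hn => by
    rw [finVec_apply_of_notMem f hn, norm_zero, zero_pow two_ne_zero]]
  exact Finset.sum_congr rfl fun n hn => by rw [finVec_apply_of_mem f hn]

lemma inner_finVec_left {ι : Type*} (X : Finset ι) (f : ι → ℂ) (z : lp (fun _ : ι => ℂ) 2) :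
    inner ℂ (finVec X f) z = ∑ n ∈ X, z n * (starRingEnd ℂ) (f n) := by
  rw [lp.inner_eq_tsum, tsum_eq_sum fun n hn => by rw [finVec_apply_of_notMem f hn,
    inner_zero_left]]
  exact Finset.sum_congr rfl fun n hn => by rw [finVec_apply_of_mem f hn, RCLike.inner_apply]

lemma orthonormal_finVec {ι κ : Type*} {X : κ → Finset ι} {f : κ → ι → ℂ}
    (hX : ∀ i j, i ≠ j → Disjoint (X i) (X j)) (hf : ∀ i, ∑ n ∈ X i, ‖f i n‖ ^ 2 = 1) :
    Orthonormal ℂ fun i => finVec (X i) (f i) := by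
  refine ⟨fun i => ?_, fun i j hij => ?_⟩
  · have := norm_finVec_sq (X i) (f i)
    rw [hf i] at this
    exact (pow_eq_one_iff_of_nonneg (norm_nonneg _) two_ne_zero).1 this
  · simp only
    rw [inner_finVec_left]
    refine Finset.sum_eq_zero fun n hn => ?_
    rw [finVec_apply_of_notMem _ (Finset.disjoint_left.1 (hX i j hij) hn), zero_mul]

lemma exists_clm_restrict {ι : Type*} (W : Set ι) :
    ∃ P : lp (fun _ : ι => ℂ) 2 →L[ℂ] lp (fun _ : ι => ℂ) 2, ‖P‖ ≤ 1 ∧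
      (∀ z, ∀ m ∈ W, P z m = z m) ∧ ∀ z, ∀ m ∉ W, P z m = 0 := by
  classical
  obtain ⟨P, hP, hP1⟩ := exists_clm_of_rows
    (fun m => if m ∈ W then finVec {m} (fun _ => 1) else (0 : lp (fun _ : ι => ℂ) 2))
    zero_le_one fun x s => by
      rw [one_mul]
      refine le_trans (Finset.sum_le_sum fun m _ => ?_) (lp_two_sum_le x s)
      split_ifs <;> simp [inner_finVec_left]
  exact ⟨P, hP1, fun z m hm => by simp [hP, hm, inner_finVec_left], fun z m hm => by simp [hP, hm]⟩

/-! ### The lower bound -/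

/-- The coefficients of a unit vector of `ℋ²` supported on `X`, with the phases of `n ^ c`. -/
def blockCoeff (c : ℂ) (X : Finset ℕ+) (n : ℕ+) : ℂ :=
  (starRingEnd ℂ) (((n : ℕ) : ℂ) ^ (-c)) / ‖((n : ℕ) : ℂ) ^ (-c)‖ *
    ((√(1 / (n : ℝ)) / √(∑ m ∈ X, 1 / (m : ℝ)) : ℝ) : ℂ)

lemma sum_norm_blockCoeff_sq (c : ℂ) {X : Finset ℕ+} (hX : 0 < ∑ m ∈ X, 1 / (m : ℝ)) :
    ∑ n ∈ X, ‖blockCoeff c X n‖ ^ 2 = 1 := by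
  have h : ∀ n : ℕ+, ‖blockCoeff c X n‖ ^ 2 = 1 / (n : ℝ) / ∑ m ∈ X, 1 / (m : ℝ) := by
    intro n
    have hu : ‖((n : ℕ) : ℂ) ^ (-c)‖ ≠ 0 := by simp [Complex.cpow_eq_zero_iff]
    rw [blockCoeff, norm_mul, norm_div, RCLike.norm_conj, Complex.norm_real, norm_norm,
      div_self hu, one_mul, Complex.norm_real, Real.norm_eq_abs, sq_abs, div_pow,
      Real.sq_sqrt (by positivity), Real.sq_sqrt hX.le]
  rw [Finset.sum_congr rfl fun n _ => h n, ← Finset.sum_div, div_self hX.ne']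

lemma norm_natCast_cpow_neg {c : ℂ} {S : ℝ} (hcS : c.re = 1 / 2 + S) (n : ℕ+) :
    ‖((n : ℕ) : ℂ) ^ (-c)‖ = √(1 / (n : ℝ)) * Real.exp (-(S * Real.log n)) := by
  rw [← sq_eq_sq₀ (norm_nonneg _) (by positivity), norm_natCast_cpow_neg_sq, mul_pow,
    Real.sq_sqrt (by positivity), ← Real.exp_nat_mul, hcS]
  congr 2
  push_cast
  ring

lemma inner_logVec_finVec_blockCoeff {c : ℂ} (hc : 1 / 2 < c.re) {S : ℝ} (hcS : c.re = 1 / 2 + S)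
    (k : ℕ) (X : Finset ℕ+) :
    inner ℂ (logVec hc k) (finVec X (blockCoeff c X)) =
      ((∑ n ∈ X, 1 / (n : ℝ) * (Real.exp (-(S * Real.log n)) * Real.log n ^ k)) /
        √(∑ m ∈ X, 1 / (m : ℝ)) : ℝ) := by
  rw [← (hasSum_inner_logVec hc k _).tsum_eq, tsum_eq_sum (s := X), Finset.sum_div,
    Complex.ofReal_sum]
  · refine Finset.sum_congr rfl fun n hn => ?_
    have hu : (‖((n : ℕ) : ℂ) ^ (-c)‖ : ℂ) ≠ 0 := by simp [Complex.cpow_eq_zero_iff]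
    have h1 : ∀ r l : ℂ, (starRingEnd ℂ) (((n : ℕ) : ℂ) ^ (-c)) / ‖((n : ℕ) : ℂ) ^ (-c)‖ * r *
        (((n : ℕ) : ℂ) ^ (-c) * l) = ‖((n : ℕ) : ℂ) ^ (-c)‖ * r * l := by
      intro r l
      have := Complex.conj_mul' (((n : ℕ) : ℂ) ^ (-c))
      field_simp
      linear_combination r * l * this
    rw [finVec_apply_of_mem _ hn, blockCoeff, h1, norm_natCast_cpow_neg hcS]
    have h2 : √(1 / (n : ℝ)) * √(1 / (n : ℝ)) = 1 / (n : ℝ) := Real.mul_self_sqrt (by positivity)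
    rw [← Complex.ofReal_pow, ← Complex.ofReal_mul, ← Complex.ofReal_mul]
    congr 1
    linear_combination (Real.exp (-(S * Real.log n)) * Real.log n ^ k /
      √(∑ m ∈ X, 1 / (m : ℝ))) * h2
  · intro n hn
    rw [finVec_apply_of_notMem _ hn, zero_mul]

lemma mw_mul_exp_mul_pow {d : ℕ} (r : Fin d → ℝ) (l : ℝ) (α : Fin d → ℕ) :
    mw r α * (Real.exp (-((∑ j, r j) * l)) * l ^ (∑ j, α j)) = ∏ j, pois (r j * l) (α j) := by
  simp only [pois, mw, Finset.prod_mul_distrib, mul_pow, Finset.prod_div_distrib,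
    ← Real.exp_sum, Finset.sum_neg_distrib, ← Finset.sum_mul, Finset.prod_pow_eq_pow_sum]
  ring

/-- The coefficients of a unit vector of `ℋ²` supported on the image of `Y` under `qmap`, with the
phases of `expCoeff`. -/
def gridCoeff {d : ℕ} {q : Fin d → ℕ} (hq : ∀ j, 2 ≤ q j) (a : Fin d → ℂ)
    (Y : Finset (Fin d → ℕ)) : ℕ+ → ℂ :=
  Function.extend (qmap hq)
    (fun α => expCoeff a α / ‖expCoeff a α‖ * ((1 / √(Y.card : ℝ) : ℝ) : ℂ)) 0

lemma expCoeff_ne_zero {d : ℕ} {a : Fin d → ℂ} (ha : ∀ j, a j ≠ 0) (α : Fin d → ℕ) :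
    expCoeff a α ≠ 0 :=
  Finset.prod_ne_zero_iff.2 fun j _ =>
    div_ne_zero (pow_ne_zero _ (neg_ne_zero.2 (ha j))) (by exact_mod_cast (α j).factorial_ne_zero)

lemma sum_norm_gridCoeff_sq {d : ℕ} {q : Fin d → ℕ} (hq : ∀ j, 2 ≤ q j) (hind : MultIndep q)
    {a : Fin d → ℂ} (ha : ∀ j, a j ≠ 0) {Y : Finset (Fin d → ℕ)} (hY : Y.Nonempty) :
    ∑ m ∈ Y.map ⟨qmap hq, qmap_injective hq hind⟩, ‖gridCoeff hq a Y m‖ ^ 2 = 1 := by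
  have hY' : (0 : ℝ) < Y.card := by exact_mod_cast hY.card_pos
  have h : ∀ α, ‖gridCoeff hq a Y (qmap hq α)‖ ^ 2 = 1 / (Y.card : ℝ) := by
    intro α
    rw [gridCoeff, (qmap_injective hq hind).extend_apply, norm_mul, norm_div, Complex.norm_real,
      norm_norm, div_self (norm_ne_zero_iff.2 (expCoeff_ne_zero ha α)), one_mul,
      Complex.norm_real, Real.norm_eq_abs, sq_abs, div_pow, Real.sq_sqrt hY'.le, one_pow]
  rw [Finset.sum_map]
  simp only [Function.Embedding.coeFn_mk, h]
  rw [Finset.sum_const, nsmul_eq_mul, mul_one_div_cancel hY'.ne']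

lemma HasRows.inner_finVec_gridCoeff {d : ℕ} {q : Fin d → ℕ} {hq : ∀ j, 2 ≤ q j}
    (hind : MultIndep q) {a : Fin d → ℂ} (ha : ∀ j, a j ≠ 0) {c : ℂ} {hc : 1 / 2 < c.re}
    (hcS : c.re = 1 / 2 + ∑ j, ‖a j‖) {T : H2 →L[ℂ] H2} (hT : HasRows hq a hc T)
    (X : Finset ℕ+) (Y : Finset (Fin d → ℕ)) :
    inner ℂ (finVec (Y.map ⟨qmap hq, qmap_injective hq hind⟩) (gridCoeff hq a Y))
        (T (finVec X (blockCoeff c X))) =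
      ((∑ n ∈ X, 1 / (n : ℝ) * ∑ α ∈ Y, ∏ j, pois (‖a j‖ * Real.log n) (α j)) /
        (√(∑ m ∈ X, 1 / (m : ℝ)) * √(Y.card : ℝ)) : ℝ) := by
  have h1 : ∀ α, T (finVec X (blockCoeff c X)) (qmap hq α) *
      (starRingEnd ℂ) (gridCoeff hq a Y (qmap hq α)) =
      (((∑ n ∈ X, 1 / (n : ℝ) * ∏ j, pois (‖a j‖ * Real.log n) (α j)) /
        (√(∑ m ∈ X, 1 / (m : ℝ)) * √(Y.card : ℝ)) : ℝ) : ℂ) := by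
    intro α
    have h0 : (‖expCoeff a α‖ : ℂ) ≠ 0 := by simpa using expCoeff_ne_zero ha α
    have h2 : ∀ z r : ℂ, expCoeff a α * z * ((starRingEnd ℂ) (expCoeff a α) / ‖expCoeff a α‖ * r)
        = ‖expCoeff a α‖ * z * r := by
      intro z r
      have := Complex.mul_conj' (expCoeff a α)
      field_simp
      linear_combination z * r * this
    rw [hT.1, inner_rowVec, inner_logVec_finVec_blockCoeff hc hcS, gridCoeff,
      (qmap_injective hq hind).extend_apply, map_mul, map_div₀, Complex.conj_ofReal,
      Complex.conj_ofReal, h2, ← Complex.ofReal_mul, ← Complex.ofReal_mul, norm_expCoeff]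
    congr 1
    simp_rw [← mw_mul_exp_mul_pow]
    rw [← div_div, ← mul_one_div _ (√(Y.card : ℝ)), mul_div_assoc', Finset.mul_sum]
    congr 2
    · exact Finset.sum_congr rfl fun n _ => by ring
    · simp
  rw [inner_finVec_left, Finset.sum_map]
  simp only [Function.Embedding.coeFn_mk, h1]
  rw [← Complex.ofReal_sum, ← Finset.sum_div, Finset.sum_comm]
  simp_rw [Finset.mul_sum]

lemma HasRows.le_norm_inner_finVec_gridCoeff {d : ℕ} {q : Fin d → ℕ} {hq : ∀ j, 2 ≤ q j}
    (hind : MultIndep q) {a : Fin d → ℂ} (ha : ∀ j, a j ≠ 0) {c : ℂ} {hc : 1 / 2 < c.re}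
    (hcS : c.re = 1 / 2 + ∑ j, ‖a j‖) {T : H2 →L[ℂ] H2} (hT : HasRows hq a hc T)
    (X : Finset ℕ+) (A : Fin d → Finset ℕ) {b : ℝ} (hb : 0 ≤ b)
    (hA : ∀ n ∈ X, ∀ j, b ≤ ∑ k ∈ A j, pois (‖a j‖ * Real.log n) k) :
    b ^ d * √((∑ m ∈ X, 1 / (m : ℝ)) / (Fintype.piFinset A).card) ≤
      ‖inner ℂ (finVec ((Fintype.piFinset A).map ⟨qmap hq, qmap_injective hq hind⟩)
        (gridCoeff hq a (Fintype.piFinset A))) (T (finVec X (blockCoeff c X)))‖ := by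
  set μ := ∑ m ∈ X, 1 / (m : ℝ) with hμ
  have hμ0 : 0 ≤ μ := Finset.sum_nonneg fun m _ => by positivity
  have h1 : b ^ d * μ ≤
      ∑ n ∈ X, 1 / (n : ℝ) * ∑ α ∈ Fintype.piFinset A, ∏ j, pois (‖a j‖ * Real.log n) (α j) := by
    rw [mul_comm, hμ, Finset.sum_mul]
    refine Finset.sum_le_sum fun n hn => mul_le_mul_of_nonneg_left ?_ (by positivity)
    rw [← Finset.prod_univ_sum]
    calc b ^ d = ∏ _j : Fin d, b := by simp
      _ ≤ _ := Finset.prod_le_prod (fun _ _ => hb) fun j _ => hA n hn j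
  rw [hT.inner_finVec_gridCoeff hind ha hcS, Complex.norm_real]
  refine le_trans (le_of_eq ?_)
    (le_trans (div_le_div_of_nonneg_right h1 (by positivity)) (Real.le_norm_self _))
  rw [Real.sqrt_div hμ0, mul_div_assoc, ← div_div, Real.div_sqrt]

lemma log_succ_sub_log_le_one_div {n : ℕ} (hn : 0 < n) :
    Real.log ((n + 1 : ℕ) : ℝ) - Real.log n ≤ 1 / (n : ℝ) := by
  have hn' : (0 : ℝ) < n := by exact_mod_cast hn
  rw [← Real.log_div (by positivity) hn'.ne']
  refine (Real.log_le_sub_one_of_pos (by positivity)).trans (le_of_eq ?_)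
  push_cast
  field_simp
  ring

lemma exists_finset_log_mem_Icc {t N : ℝ} (ht : 0 ≤ t) (hN : 2 ≤ N) :
    ∃ X : Finset ℕ+, (∀ n ∈ X, t ≤ Real.log n ∧ Real.log n ≤ t + N) ∧
      N / 2 ≤ ∑ n ∈ X, 1 / (n : ℝ) := by
  set M := ⌈Real.exp t⌉₊ with hM
  set L := ⌊Real.exp (t + N)⌋₊ with hL
  have h1 : 1 ≤ Real.exp t := Real.one_le_exp ht
  have hM0 : 0 < M := Nat.ceil_pos.2 (by linarith)
  have hML : (M : ℝ) ≤ 2 * Real.exp t := by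
    have := Nat.ceil_lt_add_one (Real.exp_nonneg t)
    linarith
  have hL1 : Real.exp (t + N) ≤ ((L + 1 : ℕ) : ℝ) := by
    push_cast
    exact (Nat.lt_floor_add_one _).le
  have hlogM : Real.log M ≤ t + 1 := by
    calc Real.log M ≤ Real.log (2 * Real.exp t) :=
          Real.log_le_log (by exact_mod_cast hM0) hML
      _ = Real.log 2 + t := by rw [Real.log_mul (by norm_num) (Real.exp_pos t).ne', Real.log_exp]
      _ ≤ t + 1 := by linarith [Real.log_two_lt_d9]
  have hlogL : t + N ≤ Real.log ((L + 1 : ℕ) : ℝ) := by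
    rw [Real.le_log_iff_exp_le (by positivity)]
    exact hL1
  have hle : M ≤ L + 1 := by
    have h : Real.log M ≤ Real.log ((L + 1 : ℕ) : ℝ) := by linarith
    have := (Real.log_le_log_iff (by exact_mod_cast hM0) (by positivity)).1 h
    exact_mod_cast this
  refine ⟨(Finset.Ico M (L + 1)).subtype (0 < ·), fun n hn => ?_, ?_⟩
  · obtain ⟨h2, h3⟩ := Finset.mem_Ico.1 (Finset.mem_subtype.1 hn)
    have hn0 : (0 : ℝ) < ((n : ℕ) : ℝ) := by exact_mod_cast n.pos
    refine ⟨(Real.le_log_iff_exp_le hn0).2 (Nat.ceil_le.1 h2),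
      (Real.log_le_iff_le_exp hn0).2 ?_⟩
    exact (Nat.le_floor_iff (Real.exp_nonneg _)).1 (Nat.lt_succ_iff.1 h3)
  · calc N / 2 ≤ Real.log ((L + 1 : ℕ) : ℝ) - Real.log M := by linarith
      _ = ∑ n ∈ Finset.Ico M (L + 1), (Real.log ((n + 1 : ℕ) : ℝ) - Real.log n) :=
          (Finset.sum_Ico_sub (fun n : ℕ => Real.log (n : ℝ)) hle).symm
      _ ≤ ∑ n ∈ Finset.Ico M (L + 1), 1 / (n : ℝ) := Finset.sum_le_sum fun n hn =>
          log_succ_sub_log_le_one_div (hM0.trans_le (Finset.mem_Ico.1 hn).1)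
      _ = _ := (Finset.sum_subtype_of_mem (p := fun n : ℕ => 0 < n) (fun n : ℕ => 1 / (n : ℝ))
          fun n hn => hM0.trans_le (Finset.mem_Ico.1 hn).1).symm

/-- The natural numbers in the interval of radius `b` around `x`. -/
def natWindow (x b : ℝ) : Finset ℕ := Finset.Icc ⌈x - b⌉₊ ⌊x + b⌋₊

lemma abs_sub_le_of_mem_natWindow {x b : ℝ} {k : ℕ} (hxb : 0 ≤ x + b) (hk : k ∈ natWindow x b) :
    |(k : ℝ) - x| ≤ b := by
  obtain ⟨h1, h2⟩ := Finset.mem_Icc.1 hk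
  have h3 := Nat.ceil_le.1 h1
  have h4 := (Nat.le_floor_iff hxb).1 h2
  rw [abs_le]
  constructor <;> linarith

lemma lt_abs_sub_of_notMem_natWindow {x b : ℝ} {k : ℕ} (hk : k ∉ natWindow x b) :
    b < |(k : ℝ) - x| := by
  rw [natWindow, Finset.mem_Icc, not_and_or, not_le, not_le] at hk
  rcases hk with h | h
  · have := Nat.lt_ceil.1 h
    rw [lt_abs]
    right
    linarith
  · have := Nat.lt_of_floor_lt h
    rw [lt_abs]
    left
    linarith

lemma card_natWindow_le {x b : ℝ} (hxb : 0 ≤ x + b) (hb : 0 ≤ b) :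
    ((natWindow x b).card : ℝ) ≤ 2 * b + 1 := by
  rw [natWindow, Nat.card_Icc]
  rcases le_total ⌈x - b⌉₊ (⌊x + b⌋₊ + 1) with h | h
  · rw [Nat.cast_sub h]
    push_cast
    have h1 := Nat.le_ceil (x - b)
    have h2 := Nat.floor_le hxb
    linarith
  · rw [Nat.sub_eq_zero_of_le h]
    push_cast
    linarith

lemma three_div_four_le_sum_pois {r S N t l : ℝ} (hr : 0 < r) (hrS : r ≤ S) (hN : 0 < N)
    (ht : 0 ≤ t) (htN : t + N ≤ 2 * N ^ 2) (htl : t ≤ l) (hlt : l ≤ t + N) :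
    3 / 4 ≤ ∑ k ∈ natWindow (r * t) ((9 * S + 1) * N), pois (r * l) k := by
  have hS : 0 < S := hr.trans_le hrS
  have hB : 0 < ((8 * S + 1) * N) ^ 2 := by positivity
  refine le_trans ?_ (one_sub_le_sum_pois (mul_nonneg hr.le (ht.trans htl)) hB _ fun k hk => ?_)
  · have h1 : r * l ≤ 2 * S * N ^ 2 := by
      calc r * l ≤ S * (2 * N ^ 2) := mul_le_mul hrS (hlt.trans htN) (ht.trans htl) hS.le
        _ = _ := by ring
    have h2 : r * l / ((8 * S + 1) * N) ^ 2 ≤ 1 / 4 := by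
      rw [div_le_iff₀ hB]
      nlinarith [mul_nonneg (sq_nonneg (8 * S - 1)) (sq_nonneg N), mul_pos hS (pow_pos hN 2),
        sq_nonneg (S * N), sq_nonneg N]
    linarith
  · have h1 := lt_abs_sub_of_notMem_natWindow hk
    have h2 : |(k : ℝ) - r * t| ≤ |(k : ℝ) - r * l| + |r * l - r * t| := abs_sub_le _ _ _
    have h3 : |r * l - r * t| ≤ S * N := by
      rw [← mul_sub, abs_of_nonneg (mul_nonneg hr.le (by linarith))]
      exact mul_le_mul hrS (by linarith) (by linarith) hS.le
    rw [← sq_abs ((k : ℝ) - r * l)]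
    exact pow_le_pow_left₀ (by positivity) (by linarith) 2

lemma HasRows.exists_restrict {d e : ℕ} (hde : d = e + 1) {q : Fin d → ℕ} {hq : ∀ j, 2 ≤ q j}
    (hind : MultIndep q) {a : Fin d → ℂ} (ha : ∀ j, a j ≠ 0) {c : ℂ} {hc : 1 / 2 < c.re}
    (hcS : c.re = 1 / 2 + ∑ j, ‖a j‖) {T : H2 →L[ℂ] H2} (hT : HasRows hq a hc T) :
    ∃ C : ℝ, 0 < C ∧ ∀ I : ℕ, 1 ≤ I → ∃ P : H2 →L[ℂ] H2, ‖P‖ ≤ 1 ∧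
      (∀ z α, I ^ 2 ≤ ∑ j, α j + 1 → P z (qmap hq α) = z (qmap hq α)) ∧
      ‖P ∘L T‖ ≤ √(C / (I : ℝ) ^ e) := by
  classical
  obtain ⟨C, hC, hCI⟩ := exists_sum_norm_inner_rowVec_sq_le hde ha hc hcS
  refine ⟨C, hC, fun I hI => ?_⟩
  set W : Set ℕ+ := qmap hq '' {α | I ^ 2 ≤ ∑ j, α j + 1} with hW
  obtain ⟨P, hP1, hPW, hPW'⟩ := exists_clm_restrict W
  refine ⟨P, hP1, fun z α hα => hPW z _ ⟨α, hα, rfl⟩, ?_⟩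
  refine ContinuousLinearMap.opNorm_le_bound _ (Real.sqrt_nonneg _) fun x => ?_
  refine lp_two_norm_le (by positivity) fun s => ?_
  obtain ⟨t, ht, hts⟩ := hT.sum_norm_sq hind x (s.filter (· ∈ W))
  calc ∑ i ∈ s, ‖(P ∘L T) x i‖ ^ 2 = ∑ i ∈ s with i ∈ W, ‖T x i‖ ^ 2 := by
        rw [Finset.sum_filter]
        refine Finset.sum_congr rfl fun i _ => ?_
        split_ifs with hi
        · rw [ContinuousLinearMap.comp_apply, hPW _ _ hi]
        · rw [ContinuousLinearMap.comp_apply, hPW' _ _ hi, norm_zero, zero_pow two_ne_zero]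
    _ ≤ C / (I : ℝ) ^ e * ‖x‖ ^ 2 := by
        rw [hts]
        refine hCI I hI x t fun α hα => ?_
        obtain ⟨β, hβ, h⟩ := (Finset.mem_filter.1 (ht α hα)).2
        rwa [← qmap_injective hq hind h]
    _ = (√(C / (I : ℝ) ^ e) * ‖x‖) ^ 2 := by
        rw [mul_pow, Real.sq_sqrt (by positivity)]

lemma HasRows.exists_le_approxNumber {d e : ℕ} (hde : d = e + 1) {q : Fin d → ℕ}
    {hq : ∀ j, 2 ≤ q j} (hind : MultIndep q) {a : Fin d → ℂ} (ha : ∀ j, a j ≠ 0) {c : ℂ}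
    {hc : 1 / 2 < c.re} (hcS : c.re = 1 / 2 + ∑ j, ‖a j‖) {T : H2 →L[ℂ] H2}
    (hT : HasRows hq a hc T) :
    ∃ (G : ℕ) (w b : ℝ), 0 < G ∧ 0 < w ∧ 0 < b ∧ ∀ m n : ℕ, n < G * m →
      2 * (n * b) ≤ (G * m : ℕ) * w → w / √((m : ℝ) ^ e) / 4 ≤ approxNumber T (n + 1) := by
  set j₀ : Fin d := ⟨0, by omega⟩
  set S := ∑ j, ‖a j‖ with hS
  have hrS : ∀ j, ‖a j‖ ≤ S := fun j =>
    Finset.single_le_sum (f := fun j => ‖a j‖) (fun i _ => norm_nonneg _) (Finset.mem_univ j)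
  have hr : ∀ j, 0 < ‖a j‖ := fun j => norm_pos_iff.2 (ha j)
  have hS0 : 0 < S := (hr j₀).trans_le (hrS j₀)
  set ρ := 9 * S + 1 with hρ
  have hρ0 : 0 < ρ := by positivity
  obtain ⟨C, hC, hP⟩ := hT.exists_restrict hde hind ha hcS
  obtain ⟨G, hG⟩ := exists_nat_ge (2 / ‖a j₀‖ + 1)
  obtain ⟨D, hD⟩ := exists_nat_gt (2 * ρ / ‖a j₀‖ + 2)
  have hG1 : (1 : ℝ) ≤ G := le_trans (by have := div_pos two_pos (hr j₀); linarith) hG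
  have hGr : 2 ≤ ‖a j₀‖ * (G : ℝ) ^ 2 := by
    have h1 : 2 / ‖a j₀‖ ≤ G := by linarith
    rw [div_le_iff₀ (hr j₀)] at h1
    nlinarith [mul_nonneg (hr j₀).le (sub_nonneg.2 hG1), hr j₀]
  have hD2 : (2 : ℝ) < D :=
    lt_of_le_of_lt (by have := div_pos (mul_pos two_pos hρ0) (hr j₀); linarith) hD
  have hDr : 2 * ρ < ‖a j₀‖ * D := by
    rw [mul_comm ‖a j₀‖, ← div_lt_iff₀ (hr j₀)]
    linarith
  have hG0 : 0 < G := by exact_mod_cast zero_lt_one.trans_le hG1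
  have hD0 : 0 < D := by exact_mod_cast two_pos.trans hD2
  refine ⟨G, (3 / 4) ^ d * √(1 / (2 * (2 * ρ + 1) ^ d * ((D : ℝ) * G) ^ e)), √(C / (D : ℝ) ^ e),
    hG0, by positivity, by positivity, fun m n hn hnb => ?_⟩
  have hm : 0 < m := Nat.pos_of_ne_zero (by rintro rfl; simp at hn)
  have hm1 : (1 : ℝ) ≤ m := by exact_mod_cast hm
  set N : ℝ := (D : ℝ) * G * m with hN
  have hDN : (D : ℝ) ≤ N := by
    rw [hN, mul_assoc]
    exact le_mul_of_one_le_right (by positivity) (one_le_mul_of_one_le_of_one_le hG1 hm1)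
  have hN0 : 0 < N := by linarith
  set t : Fin (G * m) → ℝ := fun i => N ^ 2 + i * (D * N) with ht
  have htN : ∀ i, N ^ 2 ≤ t i := fun i => le_add_of_nonneg_right (by positivity)
  have ht0 : ∀ i, 0 ≤ t i := fun i => (sq_nonneg N).trans (htN i)
  have htN' : ∀ i, t i + N ≤ 2 * N ^ 2 := by
    intro i
    have h1 : ((i : ℕ) : ℝ) + 1 ≤ G * m := by exact_mod_cast i.2
    have h2 : (((i : ℕ) : ℝ) + 1) * (D * N) ≤ G * m * (D * N) :=
      mul_le_mul_of_nonneg_right h1 (by positivity)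
    have h3 : (G : ℝ) * m * (D * N) = N ^ 2 := by rw [hN]; ring
    simp only [ht]
    nlinarith
  have htd : ∀ i j, i < j → t i + D * N ≤ t j := by
    intro i j hij
    have h1 : ((i : ℕ) : ℝ) + 1 ≤ ((j : ℕ) : ℝ) := by exact_mod_cast hij
    have h2 := mul_le_mul_of_nonneg_right h1 (by positivity : 0 ≤ (D : ℝ) * N)
    simp only [ht]
    linarith
  choose X hXlog hXsum using fun i => exists_finset_log_mem_Icc (ht0 i) (hD2.le.trans hDN)
  set A : Fin (G * m) → Fin d → Finset ℕ := fun i j => natWindow (‖a j‖ * t i) (ρ * N) with hA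
  have hrt : ∀ i j, 0 ≤ ‖a j‖ * t i + ρ * N := fun i j =>
    add_nonneg (mul_nonneg (hr j).le (ht0 i)) (by positivity)
  have hpois : ∀ i, ∀ n ∈ X i, ∀ j, 3 / 4 ≤ ∑ k ∈ A i j, pois (‖a j‖ * Real.log n) k :=
    fun i n hn j => three_div_four_le_sum_pois (hr j) (hrS j) hN0 (ht0 i) (htN' i)
      (hXlog i n hn).1 (hXlog i n hn).2
  have hX0 : ∀ i, 0 < ∑ n ∈ X i, 1 / (n : ℝ) := fun i => (half_pos hN0).trans_le (hXsum i)
  have hAne : ∀ i j, (A i j).Nonempty := by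
    intro i j
    obtain ⟨n, hn⟩ := Finset.nonempty_of_sum_ne_zero (hX0 i).ne'
    refine Finset.nonempty_of_sum_ne_zero (f := pois (‖a j‖ * Real.log n)) ?_
    linarith [hpois i n hn j]
  have hYne : ∀ i, (Fintype.piFinset (A i)).Nonempty := fun i =>
    Fintype.piFinset_nonempty.2 (hAne i)
  have hYcard : ∀ i, ((Fintype.piFinset (A i)).card : ℝ) ≤ ((2 * ρ + 1) * N) ^ d := by
    intro i
    rw [Fintype.card_piFinset, Nat.cast_prod]
    calc ∏ j, ((A i j).card : ℝ) ≤ ∏ _j : Fin d, (2 * ρ + 1) * N :=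
          Finset.prod_le_prod (fun _ _ => Nat.cast_nonneg _) fun j _ =>
            (card_natWindow_le (hrt i j) (by positivity)).trans (by nlinarith)
      _ = _ := by simp
  have hYmem : ∀ i, ∀ α ∈ Fintype.piFinset (A i), |(α j₀ : ℝ) - ‖a j₀‖ * t i| ≤ ρ * N :=
    fun i α hα => abs_sub_le_of_mem_natWindow (hrt i j₀) (Fintype.mem_piFinset.1 hα j₀)
  have hYlarge : ∀ i, ∀ α ∈ Fintype.piFinset (A i), (D * m) ^ 2 ≤ ∑ j, α j + 1 := by
    intro i α hα
    have h1 := (abs_le.1 (hYmem i α hα)).1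
    have h2 : ‖a j₀‖ * N ^ 2 ≤ ‖a j₀‖ * t i := mul_le_mul_of_nonneg_left (htN i) (hr j₀).le
    have h3 : 2 * ρ * N ≤ ‖a j₀‖ * N ^ 2 := by
      calc 2 * ρ * N ≤ ‖a j₀‖ * D * N := mul_le_mul_of_nonneg_right hDr.le hN0.le
        _ ≤ ‖a j₀‖ * N * N := by
          exact mul_le_mul_of_nonneg_right (mul_le_mul_of_nonneg_left hDN (hr j₀).le) hN0.le
        _ = _ := by ring
    have h4 : 2 * ((D : ℝ) * m) ^ 2 ≤ ‖a j₀‖ * N ^ 2 := by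
      calc 2 * ((D : ℝ) * m) ^ 2 ≤ ‖a j₀‖ * (G : ℝ) ^ 2 * ((D : ℝ) * m) ^ 2 :=
            mul_le_mul_of_nonneg_right hGr (sq_nonneg _)
        _ = _ := by rw [hN]; ring
    have h5 : ((D : ℝ) * m) ^ 2 ≤ α j₀ := by linarith
    have h6 : (D * m) ^ 2 ≤ α j₀ := by exact_mod_cast h5
    exact h6.trans (le_trans (Finset.single_le_sum (fun _ _ => Nat.zero_le _)
      (Finset.mem_univ j₀)) (Nat.le_succ _))
  obtain ⟨P, hP1, hPz, hPT⟩ := hP (D * m) (Nat.mul_pos hD0 hm)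
  have hinj := qmap_injective hq hind
  have hXdisj : ∀ i j, i < j → Disjoint (X i) (X j) := fun i j hij => by
    refine Finset.disjoint_left.2 fun n hi hj => ?_
    have h1 := (hXlog i n hi).2
    have h2 := (hXlog j n hj).1
    have h3 := htd i j hij
    nlinarith
  have hYdisj : ∀ i j, i < j →
      Disjoint (Fintype.piFinset (A i)) (Fintype.piFinset (A j)) := fun i j hij => by
    refine Finset.disjoint_left.2 fun α hi hj => ?_
    have h1 := (abs_le.1 (hYmem i α hi)).2
    have h2 := (abs_le.1 (hYmem j α hj)).1
    have h3 := mul_le_mul_of_nonneg_left (htd i j hij) (hr j₀).le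
    have h4 := mul_lt_mul_of_pos_right hDr hN0
    nlinarith
  refine le_approxNumber_of_orthonormal (n := n) (P := P)
    (x := fun i => finVec (X i) (blockCoeff c (X i)))
    (y := fun i => finVec ((Fintype.piFinset (A i)).map ⟨qmap hq, hinj⟩)
      (gridCoeff hq a (Fintype.piFinset (A i))))
    (b := √(C / (D : ℝ) ^ e) / √((m : ℝ) ^ e)) ?_ ?_ hn hP1 ?_ ?_ ?_ ?_
  · refine orthonormal_finVec (fun i j hij => ?_) fun i => sum_norm_blockCoeff_sq c (hX0 i)
    exact hij.lt_or_gt.elim (hXdisj i j) fun h => (hXdisj j i h).symm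
  · refine orthonormal_finVec (fun i j hij => ?_) fun i =>
      sum_norm_gridCoeff_sq hq hind ha (hYne i)
    rw [Finset.disjoint_map]
    exact hij.lt_or_gt.elim (hYdisj i j) fun h => (hYdisj j i h).symm
  · intro i z
    rw [inner_finVec_left, inner_finVec_left]
    refine Finset.sum_congr rfl fun k hk => ?_
    obtain ⟨α, hα, rfl⟩ := Finset.mem_map.1 hk
    rw [Function.Embedding.coeFn_mk, hPz z α (hYlarge i α hα)]
  · refine hPT.trans (le_of_eq ?_)
    rw [← Real.sqrt_div (by positivity), div_div, ← mul_pow]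
    push_cast
    rfl
  · intro i
    refine le_trans ?_ (hT.le_norm_inner_finVec_gridCoeff hind ha hcS (X i) (A i)
      (by norm_num : (0 : ℝ) ≤ 3 / 4) (hpois i))
    rw [mul_div_assoc, ← Real.sqrt_div (by positivity)]
    refine mul_le_mul_of_nonneg_left (Real.sqrt_le_sqrt ?_) (by positivity)
    have hY0 : (0 : ℝ) < (Fintype.piFinset (A i)).card := by exact_mod_cast (hYne i).card_pos
    calc 1 / (2 * (2 * ρ + 1) ^ d * ((D : ℝ) * G) ^ e) / (m : ℝ) ^ e
        = N / 2 / ((2 * ρ + 1) * N) ^ d := by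
          rw [mul_pow _ N, hde, pow_succ N, hN]
          field_simp
          exact mul_pow _ _ _
      _ ≤ _ := div_le_div₀ (hX0 i).le (hXsum i) hY0 (hYcard i)
  · rw [← mul_div_assoc, ← mul_div_assoc, ← mul_div_assoc]
    exact div_le_div_of_nonneg_right hnb (Real.sqrt_nonneg _)

lemma HasRows.not_summable_approxNumber {d e : ℕ} (he : 1 ≤ e) (hde : d = e + 1) {q : Fin d → ℕ}
    {hq : ∀ j, 2 ≤ q j} (hind : MultIndep q) {a : Fin d → ℂ} (ha : ∀ j, a j ≠ 0) {c : ℂ}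
    {hc : 1 / 2 < c.re} (hcS : c.re = 1 / 2 + ∑ j, ‖a j‖) {T : H2 →L[ℂ] H2}
    (hT : HasRows hq a hc T) :
    ¬ Summable fun n : ℕ => approxNumber T (n + 1) ^ (2 / (e : ℝ)) := by
  obtain ⟨G, w, b, hG, hw, hb, h⟩ := hT.exists_le_approxNumber hde hind ha hcS
  obtain ⟨Q, hQ⟩ := exists_nat_ge (2 * b / w + 1)
  have hQ1 : (1 : ℝ) ≤ Q := le_trans (by have := div_pos (mul_pos two_pos hb) hw; linarith) hQ
  have hQw : 2 * b ≤ Q * w := by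
    rw [← div_le_iff₀ hw]
    linarith
  have hQ0 : 1 ≤ Q := by exact_mod_cast hQ1
  have hG1 : (1 : ℝ) ≤ G := by exact_mod_cast hG
  refine not_summable_rpow_of_le he (K := w / √((Q : ℝ) ^ e) / 4) (by positivity) fun n => ?_
  refine le_trans (le_of_eq ?_) (h (Q * (n + 1)) n ?_ ?_)
  · push_cast
    rw [mul_pow, Real.sqrt_mul (by positivity)]
    field_simp
  · have := Nat.mul_le_mul hG (Nat.mul_le_mul hQ0 (le_refl (n + 1)))
    omega
  · push_cast
    calc 2 * ((n : ℝ) * b) = n * (2 * b) := by ring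
      _ ≤ (n + 1) * (Q * w) := mul_le_mul (by linarith) hQw (by positivity) (by positivity)
      _ ≤ G * ((n + 1) * (Q * w)) := le_mul_of_one_le_left (by positivity) hG1
      _ = _ := by ring

theorem stmt7 (d : ℕ) (hd : 2 ≤ d) (q : Fin d → ℕ) (hq : ∀ j, 2 ≤ q j)
    (hind : MultIndep q) (a : Fin d → ℂ) (ha : ∀ j, a j ≠ 0) (c₁ : ℂ)
    (hκ : c₁.re - ∑ j, ‖a j‖ = 1 / 2) :
    ∃ T : H2 →L[ℂ] H2,
      IsCompOp (fun s => c₁ + ∑ j, a j * (q j : ℂ) ^ (-s)) T ∧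
      (∀ p : ℝ, 2 / ((d : ℝ) - 1) < p →
        Summable fun n : ℕ => approxNumber T (n + 1) ^ p) ∧
      ¬ Summable fun n : ℕ => approxNumber T (n + 1) ^ (2 / ((d : ℝ) - 1)) := by
  obtain ⟨e, rfl⟩ : ∃ e, d = e + 1 := ⟨d - 1, by omega⟩
  have hcS : c₁.re = 1 / 2 + ∑ j, ‖a j‖ := by linarith
  have hS : 0 < ∑ j, ‖a j‖ :=
    Finset.sum_pos (fun j _ => norm_pos_iff.2 (ha j)) Finset.univ_nonempty
  have hc : 1 / 2 < c₁.re := by linarith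
  have he : 1 ≤ e := by omega
  have hcast : (((e + 1 : ℕ) : ℝ)) - 1 = e := by push_cast; ring
  obtain ⟨T, hT⟩ := exists_hasRows (by omega) hq hind ha hc hcS
  rw [hcast]
  exact ⟨T, hT.isCompOp hind ha hcS, fun p hp => hT.summable_approxNumber he rfl hind ha hcS hp,
    hT.not_summable_approxNumber he rfl hind ha hcS⟩
end
end

section
/- Let d ≥ 1 be an integer, let c₁ > 1/2 be a real number and let a₁,…,a_d be negative real numbers with c₁ + ∑_{j=1}^d a_j = 1/2. Define Φ : 𝕋^d → ℂ by Φ(z) = c₁ + ∑_{j=1}^d a_j z_j, where 𝕋 = {z ∈ ℂ : |z| = 1}. Then Re Φ(z) ≥ 1/2 for all z ∈ 𝕋^d, and there exists a constant C (depending on d, c₁ and the a_j) such that for every ε ∈ (0,1] and every t₀ ∈ ℝ: m_d({z ∈ 𝕋^d : Re Φ(z) ≤ 1/2 + ε and |Im Φ(z) − t₀| ≤ ε/2}) ≤ C·ε^{(d+1)/2}, where m_d denotes the normalized Haar measure (the product of normalized arc-length measures) on 𝕋^d. -/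
open Complex MeasureTheory

theorem abs_le_of_half_le_cos {x : ℝ} (hx : |x| ≤ Real.pi) (hc : 1 / 2 ≤ Real.cos x) :
    |x| ≤ Real.pi / 3 := by
  by_contra! h
  have := Real.cos_lt_cos_of_nonneg_of_le_pi (by positivity) hx h
  rw [Real.cos_pi_div_three, Real.cos_abs] at this
  linarith

theorem abs_sub_le_two_mul_abs_sin_sub {x y : ℝ} (hx : |x| ≤ Real.pi / 3)
    (hy : |y| ≤ Real.pi / 3) : |x - y| ≤ 2 * |Real.sin x - Real.sin y| := by
  wlog hxy : y ≤ x generalizing x y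
  · rw [abs_sub_comm, abs_sub_comm (Real.sin x)]
    exact this hy hx (le_of_not_ge hxy)
  have key := (convex_Icc (-(Real.pi / 3)) (Real.pi / 3)).mul_sub_le_image_sub_of_le_deriv
    (f := Real.sin) Real.continuous_sin.continuousOn
    Real.differentiable_sin.differentiableOn (C := 1 / 2)
    (by
      intro u hu
      rw [interior_Icc] at hu
      rw [Real.deriv_sin, ← Real.cos_abs u, ← Real.cos_pi_div_three]
      exact Real.cos_le_cos_of_nonneg_of_le_pi (abs_nonneg u) (by linarith [Real.pi_pos])
        (abs_le.2 ⟨hu.1.le, hu.2.le⟩)) y (abs_le.1 hy) x (abs_le.1 hx) hxy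
  rw [abs_of_nonneg (sub_nonneg.2 hxy)]
  linarith [le_abs_self (Real.sin x - Real.sin y)]

theorem volume_abs_mul_sin_sub_le {b s ε c : ℝ} (hb : b < 0) :
    volume {x : ℝ | |x - c| ≤ Real.pi ∧ 1 / 2 ≤ Real.cos (x - c) ∧
      |b * Real.sin (x - c) - s| ≤ ε / 2} ≤ ENNReal.ofReal (2 * ε / (-b)) := by
  refine (Real.volume_le_diam _).trans (Metric.ediam_le fun x hx y hy => ?_)
  rw [edist_dist, Real.dist_eq]
  refine ENNReal.ofReal_le_ofReal ?_
  have h := abs_sub_le_two_mul_abs_sin_sub (abs_le_of_half_le_cos hx.1 hx.2.1)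
    (abs_le_of_half_le_cos hy.1 hy.2.1)
  have h2 : |b * (Real.sin (x - c) - Real.sin (y - c))| ≤ ε := by
    have h3 := abs_le.1 hx.2.2
    have h4 := abs_le.1 hy.2.2
    rw [abs_le]
    constructor <;> linarith [h3.1, h3.2, h4.1, h4.2]
  rw [abs_mul, abs_of_neg hb] at h2
  rw [sub_sub_sub_cancel_right] at h
  rw [le_div_iff₀ (neg_pos.2 hb)]
  nlinarith

theorem volume_Ico_abs_mul_sin_sub_le {b s ε : ℝ} (hb : b < 0) :
    volume {x : ℝ | x ∈ Set.Ico 0 (2 * Real.pi) ∧ 1 / 2 ≤ Real.cos x ∧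
      |b * Real.sin x - s| ≤ ε / 2} ≤ 2 * ENNReal.ofReal (2 * ε / (-b)) := by
  rw [two_mul (ENNReal.ofReal _)]
  refine le_trans (measure_mono ?_) ((measure_union_le _ _).trans (add_le_add
    (volume_abs_mul_sin_sub_le (b := b) (s := s) (ε := ε) (c := 0) hb)
    (volume_abs_mul_sin_sub_le (b := b) (s := s) (ε := ε) (c := 2 * Real.pi) hb)))
  rintro x ⟨⟨h0, h1⟩, h2, h3⟩
  rcases le_total x Real.pi with h | h
  · left
    simp only [Set.mem_ofPred_eq, sub_zero]
    exact ⟨by rwa [abs_of_nonneg h0], h2, h3⟩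
  · right
    simp only [Set.mem_ofPred_eq, Real.cos_sub_two_pi, Real.sin_sub_two_pi]
    exact ⟨abs_le.2 ⟨by linarith, by linarith [Real.pi_pos]⟩, h2, h3⟩

theorem prod_abs_mul_sin_add_le {Y : Type*} [MeasurableSpace Y] (ν : Measure Y) [SFinite ν]
    {B : Set Y} (hB : MeasurableSet B) {g : Y → ℝ} (hg : Measurable g) {b t ε : ℝ} (hb : b < 0) :
    (volume.prod ν) {p : ℝ × Y | p.2 ∈ B ∧ p.1 ∈ Set.Ico 0 (2 * Real.pi) ∧
      1 / 2 ≤ Real.cos p.1 ∧ |b * Real.sin p.1 + g p.2 - t| ≤ ε / 2} ≤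
      2 * ENNReal.ofReal (2 * ε / (-b)) * ν B := by
  have hm : MeasurableSet {p : ℝ × Y | p.2 ∈ B ∧ p.1 ∈ Set.Ico 0 (2 * Real.pi) ∧
      1 / 2 ≤ Real.cos p.1 ∧ |b * Real.sin p.1 + g p.2 - t| ≤ ε / 2} := by
    have hcos : MeasurableSet {p : ℝ × Y | 1 / 2 ≤ Real.cos p.1} :=
      measurableSet_le (by fun_prop) (by fun_prop)
    have hsin : MeasurableSet {p : ℝ × Y | |b * Real.sin p.1 + g p.2 - t| ≤ ε / 2} :=
      measurableSet_le (by fun_prop) (by fun_prop)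
    exact (measurable_snd hB).inter
      ((measurable_fst measurableSet_Ico).inter (hcos.inter hsin))
  rw [Measure.prod_apply_symm hm, ← lintegral_indicator_const hB]
  refine lintegral_mono fun y => ?_
  by_cases hy : y ∈ B
  · rw [Set.indicator_of_mem hy]
    refine le_trans (measure_mono ?_)
      (volume_Ico_abs_mul_sin_sub_le (b := b) (s := t - g y) (ε := ε) hb)
    rintro x ⟨-, h1, h2, h3⟩
    refine ⟨h1, h2, ?_⟩
    convert h3 using 2
    ring
  · rw [Set.indicator_of_notMem hy]
    simp [hy]

theorem mem_closedBall_union_of_mul_one_sub_cos_le {x α ε : ℝ} (hα : 0 < α) (hε : 0 ≤ ε)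
    (hx : x ∈ Set.Ico 0 (2 * Real.pi)) (h : α * (1 - Real.cos x) ≤ ε) :
    x ∈ Metric.closedBall 0 (Real.pi / √(2 * α) * √ε) ∪
      Metric.closedBall (2 * Real.pi) (Real.pi / √(2 * α) * √ε) := by
  have key : ∀ y : ℝ, |y| ≤ Real.pi → α * (1 - Real.cos y) ≤ ε →
      |y| ≤ Real.pi / √(2 * α) * √ε := by
    intro y hy h
    have hc := Real.cos_le_one_sub_mul_cos_sq hy
    refine abs_le_of_sq_le_sq ?_ (by positivity)
    rw [mul_pow, div_pow, Real.sq_sqrt (by positivity), Real.sq_sqrt hε]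
    have h1 : α * (2 / Real.pi ^ 2 * y ^ 2) ≤ ε :=
      (mul_le_mul_of_nonneg_left (by linarith) hα.le).trans h
    calc y ^ 2 = Real.pi ^ 2 / (2 * α) * (α * (2 / Real.pi ^ 2 * y ^ 2)) := by
          field_simp [Real.pi_ne_zero]
      _ ≤ _ := by gcongr
  rcases le_total x Real.pi with h' | h'
  · left
    rw [Metric.mem_closedBall, Real.dist_eq, sub_zero]
    exact key x (by rwa [abs_of_nonneg hx.1]) h
  · right
    rw [Metric.mem_closedBall, Real.dist_eq]
    exact key _ (abs_le.2 ⟨by linarith, by linarith [Real.pi_pos, hx.2]⟩)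
      (by rwa [Real.cos_sub_two_pi])

theorem volume_pi_closedBall_union_le (n : ℕ) (u v : ℝ) {r : ℝ} (hr : 0 ≤ r) :
    volume (Set.univ.pi fun _ : Fin n => Metric.closedBall u r ∪ Metric.closedBall v r) ≤
      ENNReal.ofReal ((4 * r) ^ n) := by
  rw [volume_pi_pi, Finset.prod_const, Finset.card_univ, Fintype.card_fin,
    ENNReal.ofReal_pow (by positivity)]
  gcongr
  refine (measure_union_le _ _).trans ?_
  rw [Real.volume_closedBall, Real.volume_closedBall, ← ENNReal.ofReal_add (by positivity)
    (by positivity)]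
  exact ENNReal.ofReal_le_ofReal (by linarith)

theorem volume_trig_sublevel_le {n : ℕ} {a : Fin (n + 1) → ℝ} {α ε : ℝ} (hα : 0 < α)
    (ha : ∀ j, α ≤ -a j) (hε : 0 ≤ ε) (hεα : ε ≤ α / 2) (t : ℝ) :
    volume {θ : Fin (n + 1) → ℝ | (∀ j, θ j ∈ Set.Ico (0 : ℝ) (2 * Real.pi)) ∧
      ∑ j, -a j * (1 - Real.cos (θ j)) ≤ ε ∧ |∑ j, a j * Real.sin (θ j) - t| ≤ ε / 2} ≤
      ENNReal.ofReal (4 * ε / α * (4 * (Real.pi / √(2 * α) * √ε)) ^ n) := by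
  set r := Real.pi / √(2 * α) * √ε
  have hr0 : 0 ≤ r := by positivity
  set B : Set (Fin n → ℝ) := Set.univ.pi fun _ =>
    Metric.closedBall 0 r ∪ Metric.closedBall (2 * Real.pi) r
  have hB : MeasurableSet B := MeasurableSet.univ_pi fun _ =>
    Metric.isClosed_closedBall.measurableSet.union Metric.isClosed_closedBall.measurableSet
  have hbound := prod_abs_mul_sin_add_le (volume : Measure (Fin n → ℝ)) hB
    (g := fun y => ∑ j, a (Fin.succ j) * Real.sin (y j)) (by fun_prop) (b := a 0) (t := t)
    (ε := ε) (by linarith [ha 0])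
  have hmp := volume_preserving_piFinSuccAbove (fun _ : Fin (n + 1) => ℝ) 0
  calc _ ≤ volume ((MeasurableEquiv.piFinSuccAbove (fun _ : Fin (n + 1) => ℝ) 0) ⁻¹' _) :=
        measure_mono ?_
    _ = _ := hmp.measure_preimage_equiv _
    _ ≤ _ := hbound
    _ ≤ 2 * ENNReal.ofReal (2 * ε / α) * ENNReal.ofReal ((4 * r) ^ n) := by
        gcongr
        · exact ha 0
        · exact volume_pi_closedBall_union_le n _ _ hr0
    _ = _ := by
        rw [← ENNReal.ofReal_ofNat 2, ← ENNReal.ofReal_mul (by norm_num),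
          ← ENNReal.ofReal_mul (by positivity)]
        congr 1
        ring
  rintro θ ⟨h1, h2, h3⟩
  have hj : ∀ j, α * (1 - Real.cos (θ j)) ≤ ε := fun j =>
    calc α * (1 - Real.cos (θ j)) ≤ -a j * (1 - Real.cos (θ j)) :=
          mul_le_mul_of_nonneg_right (ha j) (by linarith [Real.cos_le_one (θ j)])
      _ ≤ ∑ j, -a j * (1 - Real.cos (θ j)) :=
          Finset.single_le_sum (f := fun j => -a j * (1 - Real.cos (θ j))) (fun i _ =>
            mul_nonneg (by linarith [ha i]) (by linarith [Real.cos_le_one (θ i)]))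
            (Finset.mem_univ j)
      _ ≤ ε := h2
  refine ⟨fun j _ => mem_closedBall_union_of_mul_one_sub_cos_le hα hε (h1 j.succ) (hj j.succ),
    h1 0, ?_, ?_⟩
  · have h := hj 0
    change 1 / 2 ≤ Real.cos (θ 0)
    by_contra! hlt
    nlinarith
  · rw [Fin.sum_univ_succ] at h3
    exact h3

/-- For `Φ(z) = c₁ + ∑ a_j z_j` on the torus `𝕋^d`, with `c₁ > 1/2`, `a_j < 0` and
`c₁ + ∑ a_j = 1/2`: `Re Φ ≥ 1/2` on `𝕋^d`, and the normalized Haar measure (written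
via the angle parametrization `z_j = e^{iθ_j}`, `θ ∈ [0,2π)^d`) of the set where
`Re Φ ≤ 1/2 + ε` and `|Im Φ − t₀| ≤ ε/2` is at most `C ε^{(d+1)/2}`. -/
theorem stmt18 (d : ℕ) (hd : 1 ≤ d) (c₁ : ℝ) (hc₁ : 1 / 2 < c₁)
    (a : Fin d → ℝ) (ha : ∀ j, a j < 0) (hsum : c₁ + ∑ j, a j = 1 / 2) :
    (∀ z : Fin d → ℂ, (∀ j, ‖z j‖ = 1) →
      1 / 2 ≤ ((c₁ : ℂ) + ∑ j, (a j : ℂ) * z j).re) ∧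
    ∃ C : ℝ, 0 < C ∧ ∀ ε : ℝ, ε ∈ Set.Ioc (0 : ℝ) 1 → ∀ t₀ : ℝ,
      (volume {θ : Fin d → ℝ |
          (∀ j, θ j ∈ Set.Ico (0 : ℝ) (2 * Real.pi)) ∧
          ((c₁ : ℂ) + ∑ j, (a j : ℂ) * Complex.exp (θ j * Complex.I)).re ≤ 1 / 2 + ε ∧
          |((c₁ : ℂ) + ∑ j, (a j : ℂ) * Complex.exp (θ j * Complex.I)).im - t₀| ≤
            ε / 2}).toReal ≤
        (2 * Real.pi) ^ d * (C * ε ^ (((d : ℝ) + 1) / 2)) := by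
  constructor
  · intro z hz
    simp only [add_re, ofReal_re, re_sum, re_ofReal_mul]
    rw [← hsum]
    gcongr with j
    nlinarith [ha j, re_le_norm (z j), hz j]
  obtain ⟨n, rfl⟩ : ∃ n, d = n + 1 := ⟨d - 1, by omega⟩
  obtain ⟨j₀, hj₀⟩ := Finite.exists_min fun j => -a j
  set α := -a j₀
  have hα : 0 < α := neg_pos.2 (ha j₀)
  set p : ℝ := ((n + 1 : ℕ) + 1 : ℝ) / 2 with hp
  set K : ℝ := 4 / α * (4 * (Real.pi / √(2 * α))) ^ n with hK
  have hpi := Real.pi_pos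
  have hK0 : 0 < K := by positivity
  have hε₀ : 0 < (α / 2) ^ p := by positivity
  refine ⟨K / (2 * Real.pi) ^ (n + 1) + 1 / (α / 2) ^ p, by positivity, fun ε hε t => ?_⟩
  have hεp : 0 < ε ^ p := Real.rpow_pos_of_pos hε.1 p
  have hpi0 : 0 < (2 * Real.pi) ^ (n + 1) := by positivity
  rcases le_total ε (α / 2) with hsmall | hlarge
  · calc _ ≤ K * ε ^ p := by
          refine ENNReal.toReal_le_of_le_ofReal (by positivity) ?_
          have hpow : ε ^ p = √ε ^ n * ε := by
            rw [Real.sqrt_eq_rpow, ← Real.rpow_mul_natCast hε.1.le]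
            conv_rhs => rw [← Real.rpow_one ε, ← Real.rpow_mul hε.1.le, ← Real.rpow_add hε.1]
            congr 1
            rw [hp]
            push_cast
            ring
          have hKε : K * ε ^ p = 4 * ε / α * (4 * (Real.pi / √(2 * α) * √ε)) ^ n := by
            rw [hpow, hK, ← mul_assoc 4, mul_pow _ (√ε)]
            ring
          rw [hKε]
          refine le_trans (measure_mono ?_) (volume_trig_sublevel_le hα hj₀ hε.1.le hsmall t)
          rintro θ ⟨h1, h2, h3⟩
          simp only [add_re, ofReal_re, re_sum, re_ofReal_mul, exp_ofReal_mul_I_re] at h2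
          simp only [add_im, ofReal_im, im_sum, im_ofReal_mul, exp_ofReal_mul_I_im,
            zero_add] at h3
          refine ⟨h1, ?_, h3⟩
          simp only [mul_sub, mul_one, neg_mul, Finset.sum_sub_distrib, Finset.sum_neg_distrib]
          linarith
      _ = (2 * Real.pi) ^ (n + 1) * (K / (2 * Real.pi) ^ (n + 1) * ε ^ p) := by
          field_simp
      _ ≤ _ := by
          gcongr
          linarith [one_div_pos.2 hε₀]
  · calc _ ≤ (2 * Real.pi) ^ (n + 1) := by
          refine ENNReal.toReal_le_of_le_ofReal hpi0.le ?_
          calc _ ≤ volume (Set.univ.pi fun _ : Fin (n + 1) => Set.Ico 0 (2 * Real.pi)) :=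
                measure_mono fun θ hθ j _ => hθ.1 j
            _ = _ := by
                rw [volume_pi_pi]
                simp [ENNReal.ofReal_pow hpi.le, mul_pow, ENNReal.ofReal_mul]
      _ = (2 * Real.pi) ^ (n + 1) * (1 / (α / 2) ^ p * (α / 2) ^ p) := by
          field_simp
      _ ≤ _ := by
          have : 0 < p := by positivity
          gcongr
          linarith [div_pos hK0 hpi0]
end
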